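/- There exist constants C > 0 and c > 0 such that the following holds for every constant ε > 0 and all sufficiently large n. Let a, b ≥ 1 with d := a + b satisfying 5·log n < d < n^{1/3 − ε} and a − b ≥ C·sqrt(d), and let G be drawn from the stochastic block model G_{2n, a/n, b/n}. Let N = D^{−1/2} A D^{−1/2} with eigenvalues λ1 ≥ λ2 ≥ … ≥ λ_{2n}, and let w2 be a unit eigenvector of N for λ2 with ⟨w2, χ⟩ ≥ 0. Then with probability at least 1 − n^{−c} there is a set S of vertices with |S| ≤ C·n·d/(a − b)² such that for every vertex i ∉ S: |sqrt(2·n·d)·(D^{−1/2} w2)(i) − χ(i)| ≤ 1/100. -/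

import Mathlib

open MeasureTheory

/-- The Bernoulli measure on `Bool` with parameter `p`. -/
noncomputable def bern (p : ℝ) : Measure Bool :=
  p.toNNReal • Measure.dirac true + (1 - p).toNNReal • Measure.dirac false

/-- The stochastic block model `G_{2n,p,q}`: a symmetric random graph on `2n` vertices,
encoded by independent Bernoulli edge indicators `ω i j` (only the coordinates with
`i ≤ j` are used by `adjOf`), where the pair `{i,j}` (self-loop pairs included) is an
edge with probability `p` if `i,j` are in the same community (`V₁ = {i | i < n}`,
`V₂ = {i | n ≤ i}`) and with probability `q` otherwise. -/
noncomputable def sbm (n : ℕ) (p q : ℝ) :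
    Measure (Fin (2 * n) → Fin (2 * n) → Bool) :=
  Measure.pi fun i => Measure.pi fun j =>
    bern (if i.val < n ↔ j.val < n then p else q)

/-- The (symmetric, 0/1) adjacency matrix determined by the edge indicators `ω`. -/
noncomputable def adjOf {m : ℕ} (ω : Fin m → Fin m → Bool) : Matrix (Fin m) (Fin m) ℝ :=
  Matrix.of fun i j => if i ≤ j then (if ω i j then 1 else 0) else (if ω j i then 1 else 0)

/-- The degree of vertex `i`. -/
noncomputable def deg {m : ℕ} (ω : Fin m → Fin m → Bool) (i : Fin m) : ℝ :=
  ∑ j, adjOf ω i j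

/-- The spectral norm (ℓ²-operator norm) of a square real matrix. -/
noncomputable def specNorm {m : ℕ} (M : Matrix (Fin m) (Fin m) ℝ) : ℝ :=
  ‖Matrix.toEuclideanCLM (𝕜 := ℝ) M‖

/-- The expectation matrix `B = 𝔼[A]`: entries `a/n` within communities, `b/n` across. -/
noncomputable def Bmat (n : ℕ) (a b : ℝ) : Matrix (Fin (2*n)) (Fin (2*n)) ℝ :=
  Matrix.of fun i j => if i.val < n ↔ j.val < n then a / n else b / n

/-- The partition indicator vector `χ`: `+1` on the first community, `-1` on the second. -/
noncomputable def chi (n : ℕ) (i : Fin (2*n)) : ℝ := if i.val < n then 1 else -1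

/-- The normalized adjacency matrix `N = D^{-1/2} A D^{-1/2}`. -/
noncomputable def normAdj {m : ℕ} (ω : Fin m → Fin m → Bool) : Matrix (Fin m) (Fin m) ℝ :=
  Matrix.diagonal (fun i => (Real.sqrt (deg ω i))⁻¹) * adjOf ω *
    Matrix.diagonal (fun i => (Real.sqrt (deg ω i))⁻¹)

open Matrix

/-- The Bernoulli weight of `b` with success probability `p`. -/
noncomputable def bernWeight (p : ℝ) (b : Bool) : ℝ := if b then p else 1 - p

/-- The expectation of `f` under independent Bernoulli indicators with parameters `P i j`,
as a finite sum. -/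
noncomputable def bernExp {ι : Type*} [Fintype ι] [DecidableEq ι] (P : ι → ι → ℝ)
    (f : (ι → ι → Bool) → ℝ) : ℝ :=
  ∑ ω : ι → ι → Bool, (∏ i, ∏ j, bernWeight (P i j) (ω i j)) * f ω

lemma bernWeight_nonneg {p : ℝ} (h0 : 0 ≤ p) (h1 : p ≤ 1) (b : Bool) : 0 ≤ bernWeight p b := by
  unfold bernWeight; split_ifs <;> linarith

section bernExp

variable {ι : Type*} [Fintype ι] [DecidableEq ι] {P : ι → ι → ℝ}

lemma bernExp_mono (h0 : ∀ i j, 0 ≤ P i j) (h1 : ∀ i j, P i j ≤ 1)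
    {f g : (ι → ι → Bool) → ℝ} (h : ∀ ω, f ω ≤ g ω) : bernExp P f ≤ bernExp P g :=
  Finset.sum_le_sum fun ω _ => mul_le_mul_of_nonneg_left (h ω) <|
    Finset.prod_nonneg fun i _ => Finset.prod_nonneg fun j _ => bernWeight_nonneg (h0 i j) (h1 i j) _

lemma bernExp_const_mul (c : ℝ) (f : (ι → ι → Bool) → ℝ) :
    bernExp P (fun ω => c * f ω) = c * bernExp P f := by
  unfold bernExp
  rw [Finset.mul_sum]
  exact Finset.sum_congr rfl fun ω _ => by ring

lemma bernExp_sum {κ : Type*} (s : Finset κ) (f : κ → (ι → ι → Bool) → ℝ) :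
    bernExp P (fun ω => ∑ t ∈ s, f t ω) = ∑ t ∈ s, bernExp P (f t) := by
  unfold bernExp
  rw [Finset.sum_comm]
  exact Finset.sum_congr rfl fun ω _ => by rw [Finset.mul_sum]

lemma bernExp_prod (f : ι → ι → Bool → ℝ) :
    bernExp P (fun ω => ∏ i, ∏ j, f i j (ω i j)) =
      ∏ i, ∏ j, ∑ b, bernWeight (P i j) b * f i j b := by
  unfold bernExp
  simp_rw [← Finset.prod_mul_distrib]
  rw [← Fintype.piFinset_univ,
    ← Finset.prod_univ_sum (fun _ => (Finset.univ : Finset (ι → Bool)))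
      (fun i (x : ι → Bool) => ∏ j, bernWeight (P i j) (x j) * f i j (x j))]
  refine Finset.prod_congr rfl fun i _ => ?_
  rw [Finset.prod_univ_sum, Fintype.piFinset_univ]

/-- Expectation of a product of functions of (not necessarily distinct) indicators. -/
lemma bernExp_prod_indicators {J : Type*} [Fintype J] (e : J → ι × ι) (F : J → Bool → ℝ) :
    bernExp P (fun ω => ∏ t, F t (ω (e t).1 (e t).2)) =
      ∏ c : ι × ι, ∑ b, bernWeight (P c.1 c.2) b * ∏ t with e t = c, F t b := by
  have : (fun ω : ι → ι → Bool => ∏ t, F t (ω (e t).1 (e t).2)) =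
      fun ω => ∏ i, ∏ j, ∏ t with e t = (i, j), F t (ω i j) := by
    funext ω
    rw [← Finset.prod_fiberwise Finset.univ e, Fintype.prod_prod_type]
    refine Finset.prod_congr rfl fun i _ => Finset.prod_congr rfl fun j _ =>
      Finset.prod_congr rfl fun t ht => ?_
    rw [(Finset.mem_filter.1 ht).2]
  rw [this, bernExp_prod (fun i j b => ∏ t with e t = (i, j), F t b), Fintype.prod_prod_type]

lemma sum_bernWeight (p : ℝ) : ∑ b, bernWeight p b = 1 := by
  simp [bernWeight]

lemma bernExp_const (c : ℝ) : bernExp P (fun _ => c) = c := by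
  have := bernExp_prod (P := P) (fun _ _ _ => 1)
  simp only [Finset.prod_const_one, mul_one, sum_bernWeight] at this
  simpa [this] using bernExp_const_mul (P := P) c (fun _ => 1)

/-- Markov's inequality for `bernExp`. -/
lemma bernExp_indicator_le (h0 : ∀ i j, 0 ≤ P i j) (h1 : ∀ i j, P i j ≤ 1)
    (S : Set (ι → ι → Bool)) (f : (ι → ι → Bool) → ℝ) (hf : ∀ ω, 0 ≤ f ω)
    (hS : ∀ ω ∈ S, 1 ≤ f ω) : bernExp P (S.indicator 1) ≤ bernExp P f := by
  refine bernExp_mono h0 h1 fun ω => ?_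
  by_cases h : ω ∈ S
  · simpa [h] using hS ω h
  · simpa [h] using hf ω

end bernExp

/-- The connection probabilities of the stochastic block model. -/
noncomputable def sbmProb (n : ℕ) (p q : ℝ) (i j : Fin (2 * n)) : ℝ :=
  if i.val < n ↔ j.val < n then p else q

lemma bern_singleton (p : ℝ) (b : Bool) :
    bern p {b} = ENNReal.ofReal (bernWeight p b) := by
  cases b <;> simp [bern, bernWeight, ENNReal.ofReal]

lemma isProbabilityMeasure_bern {p : ℝ} (h0 : 0 ≤ p) (h1 : p ≤ 1) :
    IsProbabilityMeasure (bern p) := by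
  constructor
  simp only [bern, Measure.add_apply, Measure.smul_apply, measure_univ, ENNReal.smul_def,
    smul_eq_mul, mul_one]
  rw [← ENNReal.coe_add, ← Real.toNNReal_add h0 (sub_nonneg.2 h1)]
  simp

lemma sbm_apply {n : ℕ} {p q : ℝ} (hp0 : 0 ≤ p) (hp1 : p ≤ 1) (hq0 : 0 ≤ q)
    (hq1 : q ≤ 1) (S : Set (Fin (2 * n) → Fin (2 * n) → Bool)) :
    sbm n p q S = ENNReal.ofReal (bernExp (sbmProb n p q) (S.indicator 1)) := by
  classical
  have h0 (i j : Fin (2 * n)) : 0 ≤ sbmProb n p q i j := by unfold sbmProb; split_ifs <;> assumption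
  have h1 (i j : Fin (2 * n)) : sbmProb n p q i j ≤ 1 := by unfold sbmProb; split_ifs <;> assumption
  have (i j : Fin (2 * n)) : IsProbabilityMeasure (bern (if i.val < n ↔ j.val < n then p else q)) :=
    isProbabilityMeasure_bern (h0 i j) (h1 i j)
  have hs (ω) : sbm n p q {ω} =
      ENNReal.ofReal (∏ i, ∏ j, bernWeight (sbmProb n p q i j) (ω i j)) := by
    unfold sbm
    rw [Measure.pi_singleton, ENNReal.ofReal_prod_of_nonneg]
    · refine Finset.prod_congr rfl fun i _ => ?_
      rw [Measure.pi_singleton, ENNReal.ofReal_prod_of_nonneg]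
      · exact Finset.prod_congr rfl fun j _ => bern_singleton _ _
      · exact fun j _ => bernWeight_nonneg (h0 i j) (h1 i j) _
    · exact fun i _ => Finset.prod_nonneg fun j _ => bernWeight_nonneg (h0 i j) (h1 i j) _
  have hS : S = ((Finset.univ.filter (· ∈ S) : Finset _) : Set _) := by ext; simp
  conv_lhs => rw [hS]
  rw [← sum_measure_singleton]
  unfold bernExp
  rw [ENNReal.ofReal_sum_of_nonneg, Finset.sum_filter]
  · refine Finset.sum_congr rfl fun ω _ => ?_
    by_cases h : ω ∈ S <;> simp [h, hs]
  · intro ω _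
    refine mul_nonneg (Finset.prod_nonneg fun i _ => Finset.prod_nonneg fun j _ =>
      bernWeight_nonneg (h0 i j) (h1 i j) _) ?_
    by_cases h : ω ∈ S <;> simp [h]

/-- Two walks visit their vertices in the same pattern. -/
def SamePattern {V W : Type*} {k : ℕ} (u : Fin k → V) (w : Fin k → W) : Prop :=
  ∀ i j, u i = u j ↔ w i = w j

/-- Step `i` of the walk `u` reaches a vertex that was not visited before. -/
def IsNewStep {V : Type*} {k : ℕ} (u : Fin (k + 1) → V) (i : Fin k) : Prop :=
  ∀ j : Fin (k + 1), j ≤ i.castSucc → u j ≠ u i.succ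

open Classical in
/-- The product of the weights `v` over the steps of `u` that discover a new vertex. -/
noncomputable def discoveryWeight {V : Type*} (v : V → V → ℝ) {k : ℕ} (u : Fin (k + 1) → V) : ℝ :=
  ∏ i : Fin k, if IsNewStep u i then v (u i.castSucc) (u i.succ) else 1

open Classical in
/-- The number of steps of `u` that discover a new vertex. -/
noncomputable def discoveryCount {V : Type*} {k : ℕ} (u : Fin (k + 1) → V) : ℕ :=
  (Finset.univ.filter (IsNewStep u)).card

section walks

variable {V W : Type*}

lemma SamePattern.isNewStep_iff {k : ℕ} {u : Fin (k + 1) → V} {w : Fin (k + 1) → W}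
    (h : SamePattern u w) (i : Fin k) : IsNewStep u i ↔ IsNewStep w i := by
  unfold IsNewStep
  simp only [ne_eq, h _ _]

lemma SamePattern.discoveryCount_eq {k : ℕ} {u : Fin (k + 1) → V} {w : Fin (k + 1) → W}
    (h : SamePattern u w) : discoveryCount u = discoveryCount w := by
  unfold discoveryCount
  congr 1
  ext i
  simp [h.isNewStep_iff]

lemma samePattern_snoc_iff {k : ℕ} (u : Fin (k + 1) → V) (x : V) (w : Fin (k + 1) → W) (y : W) :
    SamePattern (Fin.snoc u x : Fin (k + 2) → V) (Fin.snoc w y : Fin (k + 2) → W) ↔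
      SamePattern u w ∧ ∀ j, u j = x ↔ w j = y := by
  constructor
  · intro h
    refine ⟨fun i j => ?_, fun j => ?_⟩
    · simpa using h i.castSucc j.castSucc
    · simpa using h j.castSucc (Fin.last _)
  · rintro ⟨h1, h2⟩ i j
    induction i using Fin.lastCases with
    | last =>
      induction j using Fin.lastCases with
      | last => simp
      | cast j => simpa [eq_comm] using h2 j
    | cast i =>
      induction j using Fin.lastCases with
      | last => simpa using h2 i
      | cast j => simpa using h1 i j

lemma isNewStep_snoc_castSucc {k : ℕ} (u : Fin (k + 1) → V) (x : V) (i : Fin k) :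
    IsNewStep (Fin.snoc u x : Fin (k + 2) → V) i.castSucc ↔ IsNewStep u i := by
  unfold IsNewStep
  constructor
  · intro h j hj
    have := h j.castSucc (by simpa using hj)
    rw [Fin.succ_castSucc, Fin.snoc_castSucc, Fin.snoc_castSucc] at this
    exact this
  · intro h j hj
    induction j using Fin.lastCases with
    | last =>
      exfalso
      simp only [Fin.le_def, Fin.val_last, Fin.val_castSucc] at hj
      omega
    | cast j =>
      rw [Fin.succ_castSucc, Fin.snoc_castSucc, Fin.snoc_castSucc]
      exact h j (by simpa using hj)

lemma isNewStep_snoc_last {k : ℕ} (u : Fin (k + 1) → V) (x : V) :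
    IsNewStep (Fin.snoc u x : Fin (k + 2) → V) (Fin.last k) ↔ ∀ j, u j ≠ x := by
  unfold IsNewStep
  constructor
  · intro h j
    have := h j.castSucc (by simpa using Fin.le_last j)
    simpa [Fin.succ_last] using this
  · intro h j hj
    induction j using Fin.lastCases with
    | last =>
      exfalso
      simp [Fin.le_def] at hj
    | cast j => simpa [Fin.succ_last] using h j

open Classical in
lemma discoveryWeight_snoc (v : V → V → ℝ) {k : ℕ} (u : Fin (k + 1) → V) (x : V) :
    discoveryWeight v (Fin.snoc u x : Fin (k + 2) → V) =
      discoveryWeight v u * if ∀ j, u j ≠ x then v (u (Fin.last k)) x else 1 := by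
  unfold discoveryWeight
  rw [Fin.prod_univ_castSucc]
  simp only [isNewStep_snoc_castSucc, isNewStep_snoc_last, Fin.succ_castSucc, Fin.snoc_castSucc,
    Fin.succ_last, Fin.snoc_last]

open Classical in
lemma discoveryCount_snoc {k : ℕ} (u : Fin (k + 1) → V) (x : V) :
    discoveryCount (Fin.snoc u x : Fin (k + 2) → V) =
      discoveryCount u + if ∀ j, u j ≠ x then 1 else 0 := by
  unfold discoveryCount
  simp only [Finset.card_filter]
  rw [Fin.sum_univ_castSucc]
  simp only [isNewStep_snoc_castSucc, isNewStep_snoc_last]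

lemma discoveryWeight_nonneg {v : V → V → ℝ} (hv : ∀ x y, 0 ≤ v x y) {k : ℕ}
    (u : Fin (k + 1) → V) : 0 ≤ discoveryWeight v u :=
  Finset.prod_nonneg fun i _ => by split_ifs <;> simp [hv]

lemma sum_snoc [Fintype V] {k : ℕ} (f : (Fin (k + 2) → V) → ℝ) :
    ∑ u, f u = ∑ u : Fin (k + 1) → V, ∑ x, f (Fin.snoc u x) := by
  rw [← (Fin.snocEquiv (fun _ : Fin (k + 2) => V)).sum_comp, Fintype.sum_prod_type,
    Finset.sum_comm]
  rfl

open Classical in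
lemma sum_discoveryWeight_le [Fintype V] {v : V → V → ℝ} (hv : ∀ x y, 0 ≤ v x y) {ρ : ℝ}
    (hρ : ∀ x, ∑ y, v x y ≤ ρ) {k : ℕ} (w : Fin (k + 1) → W) :
    ∑ u : Fin (k + 1) → V, (if SamePattern u w then discoveryWeight v u else 0) ≤
      Fintype.card V * ρ ^ discoveryCount w := by
  induction k with
  | zero =>
    refine (Finset.sum_le_sum (g := fun _ => (1 : ℝ)) fun u _ => ?_).trans ?_
    · split_ifs <;> simp [discoveryWeight]
    · simp [discoveryCount]
  | succ k ih =>
    obtain ⟨w', y, rfl⟩ : ∃ w' y, w = Fin.snoc w' y := ⟨Fin.init w, w (Fin.last _), by simp⟩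
    rw [sum_snoc]
    simp only [samePattern_snoc_iff, discoveryWeight_snoc, discoveryCount_snoc]
    have key : ∀ u : Fin (k + 1) → V,
        (∑ x, if SamePattern u w' ∧ ∀ j, u j = x ↔ w' j = y then
          discoveryWeight v u * (if ∀ j, u j ≠ x then v (u (Fin.last k)) x else 1) else 0) ≤
        (if SamePattern u w' then discoveryWeight v u else 0) *
          (if ∀ j, w' j ≠ y then ρ else 1) := by
      intro u
      have hd := discoveryWeight_nonneg hv u
      by_cases hu : SamePattern u w'
      · simp only [hu, true_and, if_true]
        by_cases hy : ∀ j, w' j ≠ y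
        · rw [if_pos hy]
          refine le_trans ?_ (mul_le_mul_of_nonneg_left (hρ (u (Fin.last k))) hd)
          rw [Finset.mul_sum]
          refine Finset.sum_le_sum fun x _ => ?_
          by_cases hx : ∀ j, u j ≠ x
          · rw [if_pos hx]
            split_ifs
            · exact le_rfl
            · exact mul_nonneg hd (hv _ _)
          · rw [if_neg]
            · exact mul_nonneg hd (hv _ _)
            · intro h
              exact hx fun j hj => hy j ((h j).1 hj)
        · rw [if_neg hy, mul_one]
          push Not at hy
          obtain ⟨j₀, hj₀⟩ := hy
          rw [Finset.sum_eq_single (u j₀)]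
          · have : ¬ ∀ j, u j ≠ u j₀ := fun h => h j₀ rfl
            rw [if_neg this, mul_one]
            split_ifs <;> simp [hd]
          · intro x _ hx
            rw [if_neg]
            intro h
            exact hx ((h j₀).2 hj₀).symm
          · simp
      · simp [hu]
    refine (Finset.sum_le_sum fun u _ => key u).trans ?_
    rw [← Finset.sum_mul]
    have := ih w'
    split_ifs with h
    · rcases isEmpty_or_nonempty V with hV | ⟨⟨x₀⟩⟩
      · have : IsEmpty (Fin (k + 1) → V) := ⟨fun u => hV.false (u 0)⟩
        simp
      · have hρ0 : 0 ≤ ρ := (Finset.sum_nonneg fun y _ => hv x₀ y).trans (hρ x₀)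
        calc _ ≤ (Fintype.card V * ρ ^ discoveryCount w') * ρ :=
              mul_le_mul_of_nonneg_right this hρ0
          _ = _ := by ring
    · simpa using this

open Classical in
lemma le_card_samePattern [Fintype W] {ρ k : ℕ} (hk : ρ + k ≤ Fintype.card W)
    (u : Fin (k + 1) → V) :
    Fintype.card W * (ρ : ℝ) ^ discoveryCount u ≤
      ∑ w : Fin (k + 1) → W, (if SamePattern u w then (1 : ℝ) else 0) := by
  induction k with
  | zero =>
    have : ∀ w : Fin 1 → W, SamePattern u w := by
      intro w i j
      have : i = j := Fin.ext (by omega)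
      simp [this]
    simp [this, discoveryCount]
  | succ k ih =>
    obtain ⟨u', x, rfl⟩ : ∃ u' x, u = Fin.snoc u' x := ⟨Fin.init u, u (Fin.last _), by simp⟩
    rw [sum_snoc]
    simp only [samePattern_snoc_iff, discoveryCount_snoc]
    have key : ∀ w : Fin (k + 1) → W,
        (if SamePattern u' w then (1 : ℝ) else 0) * (if ∀ j, u' j ≠ x then (ρ : ℝ) else 1) ≤
        ∑ y, if SamePattern u' w ∧ ∀ j, u' j = x ↔ w j = y then (1 : ℝ) else 0 := by
      intro w
      by_cases hw : SamePattern u' w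
      · simp only [hw, true_and, if_true, one_mul]
        by_cases hx : ∀ j, u' j ≠ x
        · rw [if_pos hx, ← Finset.sum_filter, Finset.sum_const, nsmul_eq_mul, mul_one]
          have h1 : (Finset.univ \ Finset.univ.image w) ⊆
              Finset.univ.filter fun y => ∀ j, u' j = x ↔ w j = y := by
            intro y hy
            simp only [Finset.mem_sdiff, Finset.mem_univ, Finset.mem_image, true_and,
              not_exists] at hy
            simp only [Finset.mem_filter, Finset.mem_univ, true_and]
            exact fun j => iff_of_false (hx j) (hy j)
          have h2 := Finset.card_le_card h1
          have h3 : (Finset.univ.image w).card ≤ k + 1 := by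
            simpa using Finset.card_image_le (s := Finset.univ) (f := w)
          rw [Finset.card_sdiff_of_subset (Finset.subset_univ _), Finset.card_univ] at h2
          have : ρ ≤ (Finset.univ.filter fun y => ∀ j, u' j = x ↔ w j = y).card := by omega
          exact_mod_cast this
        · rw [if_neg hx]
          push Not at hx
          obtain ⟨j₀, hj₀⟩ := hx
          rw [Finset.sum_eq_single (w j₀)]
          · rw [if_pos]
            intro j
            rw [← hj₀]
            exact hw j j₀
          · intro y _ hy
            rw [if_neg]
            intro h
            exact hy ((h j₀).1 hj₀).symm
          · simp
      · simp [hw]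
    refine le_trans ?_ (Finset.sum_le_sum fun w _ => key w)
    rw [← Finset.sum_mul]
    have := ih (by omega) u'
    split_ifs with h
    · calc _ = (Fintype.card W * (ρ : ℝ) ^ discoveryCount u') * ρ := by ring
        _ ≤ _ := mul_le_mul_of_nonneg_right this (Nat.cast_nonneg _)
    · simpa using this

open Classical in
/-- Comparison of weighted walks in `V` with unweighted walks in `W`, for any property of walks
that only depends on the pattern. -/
lemma sum_discoveryWeight_le_card [Fintype V] [Fintype W] {v : V → V → ℝ}
    (hv : ∀ x y, 0 ≤ v x y) {ρ : ℕ} (hρ0 : 0 < ρ) (hρ : ∀ x, ∑ y, v x y ≤ ρ) {k : ℕ}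
    (hk : ρ + k ≤ Fintype.card W) (G : (Fin (k + 1) → V) → Prop) (H : (Fin (k + 1) → W) → Prop)
    (hGH : ∀ u w, SamePattern u w → G u → H w) :
    ∑ u, (if G u then discoveryWeight v u else 0) ≤
      Fintype.card V / Fintype.card W * ∑ w, if H w then (1 : ℝ) else 0 := by
  have hρ' : (0 : ℝ) < ρ := by exact_mod_cast hρ0
  have hW : (0 : ℝ) < Fintype.card W := by
    have : 0 < Fintype.card W := by omega
    exact_mod_cast this
  calc ∑ u, (if G u then discoveryWeight v u else 0)
      ≤ ∑ u, ∑ w, (if H w then 1 else 0) * ((if SamePattern u w then discoveryWeight v u else 0) *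
          (Fintype.card W * (ρ : ℝ) ^ discoveryCount w)⁻¹) := by
        refine Finset.sum_le_sum fun u _ => ?_
        have hd := discoveryWeight_nonneg hv u
        by_cases hu : G u
        · rw [if_pos hu]
          have hpos : 0 < Fintype.card W * (ρ : ℝ) ^ discoveryCount u := by positivity
          have h1 := le_card_samePattern hk u
          calc discoveryWeight v u = (Fintype.card W * (ρ : ℝ) ^ discoveryCount u) *
                (discoveryWeight v u * (Fintype.card W * (ρ : ℝ) ^ discoveryCount u)⁻¹) := by
                field_simp
            _ ≤ (∑ w : Fin (k + 1) → W, (if SamePattern u w then (1 : ℝ) else 0)) *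
                (discoveryWeight v u * (Fintype.card W * (ρ : ℝ) ^ discoveryCount u)⁻¹) :=
                mul_le_mul_of_nonneg_right h1 (by positivity)
            _ ≤ _ := by
                rw [Finset.sum_mul]
                refine Finset.sum_le_sum fun w _ => ?_
                by_cases h : SamePattern u w
                · simp [h, hGH u w h hu, h.discoveryCount_eq]
                · simp [h]
        · rw [if_neg hu]
          refine Finset.sum_nonneg fun w _ => ?_
          have : 0 ≤ (Fintype.card W * (ρ : ℝ) ^ discoveryCount w)⁻¹ := by positivity
          refine mul_nonneg (by split_ifs <;> norm_num) (mul_nonneg ?_ this)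
          split_ifs <;> simp [hd]
    _ = ∑ w, (if H w then 1 else 0) * ((∑ u, if SamePattern u w then discoveryWeight v u else 0) *
          (Fintype.card W * (ρ : ℝ) ^ discoveryCount w)⁻¹) := by
        rw [Finset.sum_comm]
        simp only [Finset.mul_sum, Finset.sum_mul]
    _ ≤ ∑ w, (if H w then 1 else 0) * ((Fintype.card V : ℝ) / Fintype.card W) := by
        refine Finset.sum_le_sum fun w _ => mul_le_mul_of_nonneg_left ?_ (by split_ifs <;> norm_num)
        calc _ ≤ (Fintype.card V * (ρ : ℝ) ^ discoveryCount w) *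
              (Fintype.card W * (ρ : ℝ) ^ discoveryCount w)⁻¹ :=
              mul_le_mul_of_nonneg_right (sum_discoveryWeight_le hv hρ w) (by positivity)
          _ = _ := by field_simp
    _ = _ := by rw [← Finset.sum_mul, mul_comm]

end walks

/-- The unordered pair `{x, y}`, as an ordered pair. -/
def sortedPair {ι : Type*} [LinearOrder ι] (x y : ι) : ι × ι := (min x y, max x y)

/-- The symmetric matrix with entries `ξ i j (ω i j)` for `i ≤ j`. -/
noncomputable def symmMat {ι : Type*} [LinearOrder ι] (ξ : ι → ι → Bool → ℝ)
    (ω : ι → ι → Bool) : Matrix ι ι ℝ :=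
  Matrix.of fun x y => ξ (min x y) (max x y) (ω (min x y) (max x y))

/-- The moments of the entries of `symmMat`. -/
noncomputable def entryMoment {ι : Type*} (P : ι → ι → ℝ) (ξ : ι → ι → Bool → ℝ) (c : ι × ι)
    (m : ℕ) : ℝ :=
  ∑ b, bernWeight (P c.1 c.2) b * ξ c.1 c.2 b ^ m

/-- A closed walk that uses each of its edges at least twice. -/
def IsGoodWalk {ι : Type*} [LinearOrder ι] {k : ℕ} (u : Fin (k + 1) → ι) : Prop :=
  u 0 = u (Fin.last k) ∧ ∀ i : Fin k, ∃ j : Fin k, j ≠ i ∧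
    sortedPair (u j.castSucc) (u j.succ) = sortedPair (u i.castSucc) (u i.succ)

lemma sortedPair_eq_iff {ι : Type*} [LinearOrder ι] {x y z w : ι} :
    sortedPair x y = sortedPair z w ↔ (x = z ∧ y = w) ∨ (x = w ∧ y = z) := by
  unfold sortedPair
  constructor
  · intro h
    rw [Prod.mk.injEq] at h
    rcases le_total x y with h1 | h1 <;> rcases le_total z w with h2 | h2 <;>
      simp only [min_eq_left h1, max_eq_right h1, min_eq_right h1, max_eq_left h1,
        min_eq_left h2, max_eq_right h2, min_eq_right h2, max_eq_left h2] at h <;> tauto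
  · rintro (⟨rfl, rfl⟩ | ⟨rfl, rfl⟩)
    · rfl
    · rw [min_comm, max_comm]

lemma isGoodWalk_of_samePattern {ι κ : Type*} [LinearOrder ι] [LinearOrder κ] {k : ℕ}
    (u : Fin (k + 1) → ι) (w : Fin (k + 1) → κ) (h : SamePattern u w) (hu : IsGoodWalk u) :
    IsGoodWalk w := by
  refine ⟨(h _ _).1 hu.1, fun i => ?_⟩
  obtain ⟨j, hj, he⟩ := hu.2 i
  refine ⟨j, hj, ?_⟩
  rw [sortedPair_eq_iff] at he ⊢
  simpa only [h _ _] using he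

lemma card_steps_ne_one {ι : Type*} [LinearOrder ι] {k : ℕ} {u : Fin (k + 1) → ι} (hu : IsGoodWalk u) (c : ι × ι) :
    (Finset.univ.filter fun i : Fin k => sortedPair (u i.castSucc) (u i.succ) = c).card ≠ 1 := by
  intro h
  obtain ⟨i, hi⟩ := Finset.card_eq_one.1 h
  have hi' : sortedPair (u i.castSucc) (u i.succ) = c := by
    have : i ∈ (Finset.univ.filter fun i : Fin k => sortedPair (u i.castSucc) (u i.succ) = c) := by
      simp [hi]
    simpa using this
  obtain ⟨j, hj, he⟩ := hu.2 i
  have : j ∈ (Finset.univ.filter fun i : Fin k => sortedPair (u i.castSucc) (u i.succ) = c) := by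
    simp [he, hi']
  rw [hi] at this
  exact hj (by simpa using this)

lemma sortedPair_injOn_newSteps {ι : Type*} [LinearOrder ι] {k : ℕ} (u : Fin (k + 1) → ι) :
    Set.InjOn (fun i : Fin k => sortedPair (u i.castSucc) (u i.succ)) {i | IsNewStep u i} := by
  have key : ∀ i j : Fin k, i < j → IsNewStep u j →
      sortedPair (u i.castSucc) (u i.succ) ≠ sortedPair (u j.castSucc) (u j.succ) := by
    intro i j hij hj h
    rw [sortedPair_eq_iff] at h
    have h1 : i.castSucc ≤ j.castSucc := by simpa using hij.le
    have h2 : i.succ ≤ j.castSucc := by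
      rw [Fin.le_def, Fin.val_succ, Fin.val_castSucc]
      exact hij
    rcases h with ⟨_, h⟩ | ⟨h, _⟩
    · exact hj _ h2 h
    · exact hj _ h1 h
  intro i hi j hj h
  rcases lt_trichotomy i j with hij | hij | hij
  · exact (key i j hij hj h).elim
  · exact hij
  · exact (key j i hij hi h.symm).elim

lemma entryMoment_zero {ι : Type*} (P : ι → ι → ℝ) (ξ : ι → ι → Bool → ℝ) (c : ι × ι) : entryMoment P ξ c 0 = 1 := by
  simp only [entryMoment, pow_zero, mul_one, sum_bernWeight]

section

variable {ι : Type*} [Fintype ι] [LinearOrder ι]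

lemma pow_apply_eq_sum_walks (M : Matrix ι ι ℝ) (k : ℕ) (x y : ι) :
    (M ^ k) x y = ∑ u : Fin (k + 1) → ι, if u 0 = x ∧ u (Fin.last k) = y then
      ∏ i : Fin k, M (u i.castSucc) (u i.succ) else 0 := by
  induction k generalizing y with
  | zero =>
    rw [← (Equiv.funUnique (Fin 1) ι).symm.sum_comp]
    simp only [pow_zero, Matrix.one_apply, Finset.univ_eq_empty, Finset.prod_empty]
    by_cases h : x = y
    · subst h
      rw [Finset.sum_eq_single x] <;> simp +contextual
    · rw [if_neg h]
      refine (Finset.sum_eq_zero fun z _ => if_neg ?_).symm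
      rintro ⟨h1, h2⟩
      exact h (h1.symm.trans h2)
  | succ k ih =>
    rw [sum_snoc, pow_succ, Matrix.mul_apply]
    simp only [ih, Finset.sum_mul]
    rw [Finset.sum_comm]
    refine Finset.sum_congr rfl fun u _ => ?_
    have h0 (z : ι) : (Fin.snoc u z : Fin (k + 2) → ι) 0 = u 0 := by
      rw [← Fin.castSucc_zero, Fin.snoc_castSucc]
    simp only [h0, Fin.snoc_last]
    by_cases hx : u 0 = x
    · simp only [hx, true_and]
      rw [Finset.sum_eq_single (u (Fin.last k)), Finset.sum_eq_single y]
      · simp only [if_true]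
        rw [Fin.prod_univ_castSucc]
        simp only [Fin.succ_castSucc, Fin.snoc_castSucc, Fin.succ_last, Fin.snoc_last]
      · intro z _ hz
        simp [hz]
      · simp
      · intro z _ hz
        simp [hz.symm]
      · simp
    · simp [hx]

lemma trace_pow_eq_sum_walks (M : Matrix ι ι ℝ) (k : ℕ) :
    (M ^ k).trace = ∑ u : Fin (k + 1) → ι, if u 0 = u (Fin.last k) then
      ∏ i : Fin k, M (u i.castSucc) (u i.succ) else 0 := by
  simp only [Matrix.trace, Matrix.diag_apply, pow_apply_eq_sum_walks]
  rw [Finset.sum_comm]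
  refine Finset.sum_congr rfl fun u _ => ?_
  rw [Finset.sum_eq_single (u 0)]
  · simp [eq_comm]
  · intro z _ hz
    simp [hz.symm]
  · simp

variable {P : ι → ι → ℝ} {ξ : ι → ι → Bool → ℝ}

lemma bernExp_trace_pow (k : ℕ) :
    bernExp P (fun ω => (symmMat ξ ω ^ k).trace) =
      ∑ u : Fin (k + 1) → ι, if u 0 = u (Fin.last k) then
        ∏ c : ι × ι, entryMoment P ξ c
          (Finset.univ.filter fun i : Fin k => sortedPair (u i.castSucc) (u i.succ) = c).card
        else 0 := by
  simp only [trace_pow_eq_sum_walks]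
  rw [bernExp_sum]
  refine Finset.sum_congr rfl fun u _ => ?_
  split_ifs with h
  · have := bernExp_prod_indicators (P := P)
      (fun i : Fin k => sortedPair (u i.castSucc) (u i.succ))
      (fun i b => ξ (sortedPair (u i.castSucc) (u i.succ)).1
        (sortedPair (u i.castSucc) (u i.succ)).2 b)
    refine Eq.trans this (Finset.prod_congr rfl fun c _ => ?_)
    unfold entryMoment
    refine Finset.sum_congr rfl fun b _ => ?_
    congr 1
    rw [Finset.prod_congr rfl (g := fun _ => ξ c.1 c.2 b), Finset.prod_const]
    intro i hi
    rw [(Finset.mem_filter.1 hi).2]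
  · exact bernExp_const 0

lemma prod_entryMoment_eq_zero (h1 : ∀ c, entryMoment P ξ c 1 = 0) {k : ℕ} {u : Fin (k + 1) → ι}
    (h0 : u 0 = u (Fin.last k)) (hu : ¬ IsGoodWalk u) :
    ∏ c : ι × ι, entryMoment P ξ c
      (Finset.univ.filter fun i : Fin k => sortedPair (u i.castSucc) (u i.succ) = c).card = 0 := by
  unfold IsGoodWalk at hu
  push Not at hu
  obtain ⟨i, hi⟩ := hu h0
  refine Finset.prod_eq_zero (Finset.mem_univ (sortedPair (u i.castSucc) (u i.succ))) ?_
  have : (Finset.univ.filter fun j : Fin k => sortedPair (u j.castSucc) (u j.succ) =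
      sortedPair (u i.castSucc) (u i.succ)) = {i} := by
    ext j
    simp only [Finset.mem_filter, Finset.mem_univ, true_and, Finset.mem_singleton]
    constructor
    · intro h
      by_contra hne
      exact hi j hne h
    · rintro rfl
      rfl
  rw [this, Finset.card_singleton, h1]

open Classical in
lemma le_bernExp_trace_pow (h1 : ∀ c, entryMoment P ξ c 1 = 0)
    (h2 : ∀ c m, 2 ≤ m → 1 ≤ entryMoment P ξ c m) (k : ℕ) :
    ∑ u : Fin (k + 1) → ι, (if IsGoodWalk u then (1 : ℝ) else 0) ≤
      bernExp P (fun ω => (symmMat ξ ω ^ k).trace) := by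
  rw [bernExp_trace_pow]
  refine Finset.sum_le_sum fun u _ => ?_
  by_cases hu : IsGoodWalk u
  · rw [if_pos hu, if_pos hu.1, ← Finset.prod_const_one (s := (Finset.univ : Finset (ι × ι)))]
    refine Finset.prod_le_prod (fun _ _ => zero_le_one) fun c _ => ?_
    have := card_steps_ne_one hu c
    generalize (Finset.univ.filter fun i : Fin k =>
      sortedPair (u i.castSucc) (u i.succ) = c).card = m at this ⊢
    rcases Nat.eq_zero_or_pos m with rfl | hm
    · rw [entryMoment_zero]
    · exact h2 c m (by omega)
  · rw [if_neg hu]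
    split_ifs with h0
    · rw [prod_entryMoment_eq_zero h1 h0 hu]
    · exact le_rfl

open Classical in
lemma bernExp_trace_pow_le {v : ι → ι → ℝ} (hv1 : ∀ x y, v x y ≤ 1)
    (hvs : ∀ x y, v x y = v y x)
    (h1 : ∀ c, entryMoment P ξ c 1 = 0)
    (h2 : ∀ c m, 2 ≤ m → |entryMoment P ξ c m| ≤ v c.1 c.2) (k : ℕ) :
    bernExp P (fun ω => (symmMat ξ ω ^ k).trace) ≤
      ∑ u : Fin (k + 1) → ι, (if IsGoodWalk u then discoveryWeight v u else 0) := by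
  rw [bernExp_trace_pow]
  refine Finset.sum_le_sum fun u _ => ?_
  by_cases hu : IsGoodWalk u
  · rw [if_pos hu, if_pos hu.1]
    set e : Fin k → ι × ι := fun i => sortedPair (u i.castSucc) (u i.succ) with he
    set I := (Finset.univ.filter (IsNewStep u)).image e with hI
    have hve (i : Fin k) : v (e i).1 (e i).2 = v (u i.castSucc) (u i.succ) := by
      simp only [he, sortedPair]
      rcases le_total (u i.castSucc) (u i.succ) with h | h
      · rw [min_eq_left h, max_eq_right h]
      · rw [min_eq_right h, max_eq_left h, hvs]
    have hD : discoveryWeight v u = ∏ c : ι × ι, if c ∈ I then v c.1 c.2 else 1 := by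
      rw [Finset.prod_ite_mem, Finset.univ_inter, hI, Finset.prod_image, Finset.prod_filter]
      · simp only [hve]
        rfl
      · intro i hi j hj h
        exact sortedPair_injOn_newSteps u (by simpa using hi) (by simpa using hj) h
    rw [hD]
    refine (le_abs_self _).trans ?_
    rw [Finset.abs_prod]
    refine Finset.prod_le_prod (fun _ _ => abs_nonneg _) fun c _ => ?_
    have hne := card_steps_ne_one hu c
    split_ifs with hc
    · refine h2 c _ ?_
      obtain ⟨i, _, hi⟩ := Finset.mem_image.1 hc
      refine (Nat.two_le_iff _).2 ⟨(Finset.card_pos.2 ⟨i, ?_⟩).ne', hne⟩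
      simpa using hi
    · generalize (Finset.univ.filter fun i : Fin k =>
        sortedPair (u i.castSucc) (u i.succ) = c).card = m at hne
      change |entryMoment P ξ c m| ≤ 1
      rcases Nat.eq_zero_or_pos m with rfl | hm
      · simp [entryMoment_zero]
      · exact (h2 c m (by omega)).trans (hv1 _ _)
  · rw [if_neg hu]
    split_ifs with h0
    · rw [prod_entryMoment_eq_zero h1 h0 hu]
    · exact le_rfl

end

section norms

variable {m : ℕ}

lemma inner_toEuclideanCLM (M : Matrix (Fin m) (Fin m) ℝ) (x z : EuclideanSpace ℝ (Fin m)) :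
    inner ℝ z (Matrix.toEuclideanCLM (𝕜 := ℝ) M x) = ∑ i, ∑ j, z i * x j * M i j := by
  rw [EuclideanSpace.inner_eq_star_dotProduct, Matrix.ofLp_toEuclideanCLM]
  simp only [dotProduct, Matrix.mulVec, star_trivial, Finset.sum_mul]
  exact Finset.sum_congr rfl fun i _ => Finset.sum_congr rfl fun j _ => by ring

lemma sum_mulVec_sq_le (M : Matrix (Fin m) (Fin m) ℝ) (x : Fin m → ℝ) :
    ∑ i, (M *ᵥ x) i ^ 2 ≤ specNorm M ^ 2 * ∑ i, x i ^ 2 := by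
  have h := (Matrix.toEuclideanCLM (𝕜 := ℝ) M).le_opNorm (WithLp.toLp 2 x)
  have h2 := pow_le_pow_left₀ (norm_nonneg _) h 2
  rw [mul_pow, EuclideanSpace.real_norm_sq_eq, EuclideanSpace.real_norm_sq_eq] at h2
  simpa [Matrix.toEuclideanCLM_toLp, specNorm] using h2

lemma specNorm_sq_le_trace {S : Matrix (Fin m) (Fin m) ℝ} (hS : Sᵀ = S) :
    specNorm S ^ 2 ≤ (S ^ 2).trace := by
  have ht : (S ^ 2).trace = ∑ i, ∑ j, S i j ^ 2 := by
    simp only [pow_two, Matrix.trace, Matrix.diag_apply, Matrix.mul_apply]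
    refine Finset.sum_congr rfl fun i _ => Finset.sum_congr rfl fun j _ => ?_
    rw [← Matrix.transpose_apply S i j, hS]
  have h0 : 0 ≤ (S ^ 2).trace := by
    rw [ht]
    positivity
  have : specNorm S ≤ Real.sqrt (S ^ 2).trace := by
    refine ContinuousLinearMap.opNorm_le_bound _ (Real.sqrt_nonneg _) fun x => ?_
    refine le_of_sq_le_sq ?_ (by positivity)
    rw [mul_pow, Real.sq_sqrt h0, EuclideanSpace.real_norm_sq_eq, EuclideanSpace.real_norm_sq_eq, ht,
      Finset.sum_mul]
    refine Finset.sum_le_sum fun i _ => ?_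
    rw [Matrix.ofLp_toEuclideanCLM]
    exact Finset.sum_mul_sq_le_sq_mul_sq Finset.univ (fun j => S i j) (fun j => x j)
  calc specNorm S ^ 2 ≤ Real.sqrt (S ^ 2).trace ^ 2 :=
        pow_le_pow_left₀ (norm_nonneg _) this 2
    _ = _ := Real.sq_sqrt h0

lemma specNorm_pow_le_trace {M : Matrix (Fin m) (Fin m) ℝ} (hM : Mᵀ = M) (l : ℕ) :
    specNorm M ^ 2 ^ (l + 1) ≤ (M ^ 2 ^ (l + 1)).trace := by
  have hsa : IsSelfAdjoint (Matrix.toEuclideanCLM (𝕜 := ℝ) M) := by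
    have : IsSelfAdjoint M := by
      rw [isSelfAdjoint_iff, Matrix.star_eq_conjTranspose, Matrix.conjTranspose_eq_transpose_of_trivial, hM]
    exact this.map _
  have h := specNorm_sq_le_trace (S := M ^ 2 ^ l) (by rw [Matrix.transpose_pow, hM])
  rw [pow_succ, pow_mul, pow_mul]
  refine le_trans (le_of_eq ?_) h
  congr 1
  unfold specNorm
  rw [map_pow, hsa.norm_pow_two_pow]

lemma trace_pow_le (M : Matrix (Fin m) (Fin m) ℝ) (k : ℕ) :
    (M ^ k).trace ≤ m * specNorm M ^ k := by
  have h (i : Fin m) : (M ^ k) i i ≤ specNorm M ^ k := by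
    rcases Nat.eq_zero_or_pos k with rfl | hk
    · simp
    have h1 : (M ^ k) i i = inner ℝ (EuclideanSpace.single i (1 : ℝ))
        (Matrix.toEuclideanCLM (𝕜 := ℝ) (M ^ k) (EuclideanSpace.single i (1 : ℝ))) := by
      rw [EuclideanSpace.inner_single_left, Matrix.ofLp_toEuclideanCLM]
      simp
    rw [h1]
    refine (real_inner_le_norm _ _).trans ?_
    have h2 := (Matrix.toEuclideanCLM (𝕜 := ℝ) (M ^ k)).le_opNorm (EuclideanSpace.single i (1 : ℝ))
    have h3 : ‖Matrix.toEuclideanCLM (𝕜 := ℝ) (M ^ k)‖ ≤ specNorm M ^ k := by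
      rw [map_pow]
      exact norm_pow_le' _ hk
    simp only [PiLp.norm_single, norm_one, mul_one, one_mul] at h2 ⊢
    exact h2.trans h3
  calc (M ^ k).trace ≤ ∑ _i : Fin m, specNorm M ^ k := Finset.sum_le_sum fun i _ => h i
    _ = _ := by simp

end norms

/-- A finite `1`-net of the ball of radius `2`. -/
lemma exists_net (r : ℕ) : ∃ N : Finset (EuclideanSpace ℝ (Fin r)), N.card ≤ 5 ^ r ∧
    (∀ x ∈ N, ‖x‖ ≤ 2) ∧ ∀ x, ‖x‖ ≤ 2 → ∃ y ∈ N, ‖x - y‖ < 1 := by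
  classical
  let Sep : Finset (EuclideanSpace ℝ (Fin r)) → Prop := fun s =>
    (∀ c ∈ s, ‖c‖ ≤ 2) ∧ ∀ c ∈ s, ∀ d ∈ s, c ≠ d → 1 ≤ ‖c - d‖
  have hcard : ∀ s, Sep s → s.card ≤ 5 ^ r := by
    intro s hs
    simpa using Besicovitch.card_le_of_separated s hs.1 hs.2
  by_contra hcon
  push Not at hcon
  have : ∀ t : ℕ, ∃ s, Sep s ∧ s.card = t := by
    intro t
    induction t with
    | zero => exact ⟨∅, by simp [Sep], rfl⟩
    | succ t ih =>
      obtain ⟨s, hs, rfl⟩ := ih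
      obtain ⟨x, hx, hxs⟩ := hcon s (hcard s hs) hs.1
      have hx' : x ∉ s := fun h => by
        have := hxs x h
        norm_num at this
      refine ⟨insert x s, ⟨?_, ?_⟩, Finset.card_insert_of_notMem hx'⟩
      · intro c hc
        rcases Finset.mem_insert.1 hc with rfl | hc
        · exact hx
        · exact hs.1 c hc
      · intro c hc d hd hcd
        rcases Finset.mem_insert.1 hc with rfl | hc' <;>
          rcases Finset.mem_insert.1 hd with rfl | hd'
        · exact (hcd rfl).elim
        · exact hxs d hd'
        · rw [norm_sub_rev]
          exact hxs c hc'
        · exact hs.2 c hc' d hd' hcd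
  obtain ⟨s, hs, hc⟩ := this (5 ^ r + 1)
  have := hcard s hs
  omega

/-- The norm of an operator is attained, up to a constant, on a net. -/
lemma exists_opNorm_le_inner {E : Type*} [NormedAddCommGroup E] [InnerProductSpace ℝ E]
    (N : Finset E) (hN : ∀ x : E, ‖x‖ ≤ 2 → ∃ y ∈ N, ‖x - y‖ < 1) (T : E →L[ℝ] E) :
    ∃ x ∈ N, ∃ z ∈ N, ‖T‖ ≤ inner ℝ z (T x) := by
  obtain ⟨y0, hy0, -⟩ := hN 0 (by simp)
  obtain ⟨⟨x, z⟩, hxz, hmax⟩ := Finset.exists_max_image (N ×ˢ N)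
    (fun p => inner ℝ p.2 (T p.1)) ⟨(y0, y0), by simp [hy0]⟩
  rw [Finset.mem_product] at hxz
  refine ⟨x, hxz.1, z, hxz.2, ?_⟩
  set B := inner ℝ z (T x) with hB
  have hscale (w : E) (hw : w ≠ 0) : ‖(2 / ‖w‖) • w‖ = 2 := by
    have : ‖w‖ ≠ 0 := by simpa using hw
    rw [norm_smul, norm_div, norm_norm]
    field_simp
    simp
  have h1 : ∀ x ∈ N, ‖T x‖ ≤ B := by
    intro x' hx'
    by_cases h0 : T x' = 0
    · have := hmax (x', y0) (by simp [hx', hy0])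
      simp only [h0, inner_zero_right] at this
      simpa [h0] using this
    · set w := T x' with hw
      have hw0 : ‖w‖ ≠ 0 := by simpa using h0
      obtain ⟨y, hy, hd⟩ := hN ((2 / ‖w‖) • w) (hscale w h0).le
      have h2 : inner ℝ ((2 / ‖w‖) • w) w = 2 * ‖w‖ := by
        rw [real_inner_smul_left, real_inner_self_eq_norm_sq]
        field_simp
      have h3 : inner ℝ ((2 / ‖w‖) • w - y) w ≤ ‖w‖ := by
        refine (real_inner_le_norm _ _).trans ?_
        calc _ ≤ 1 * ‖w‖ := mul_le_mul_of_nonneg_right hd.le (norm_nonneg _)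
          _ = _ := one_mul _
      rw [inner_sub_left, h2] at h3
      have h4 := hmax (x', y) (by simp [hx', hy])
      simp only [← hw] at h4
      change inner ℝ y w ≤ B at h4
      linarith
  have hB0 : 0 ≤ B := (norm_nonneg _).trans (h1 y0 hy0)
  have h2 : ‖T‖ ≤ (B + ‖T‖) / 2 := by
    refine T.opNorm_le_bound (by positivity) fun w => ?_
    by_cases h0 : w = 0
    · simp [h0]
    · have hw0 : 0 < ‖w‖ := by simpa using h0
      obtain ⟨y, hy, hd⟩ := hN ((2 / ‖w‖) • w) (hscale w h0).le
      have h3 : ‖T ((2 / ‖w‖) • w)‖ ≤ B + ‖T‖ := by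
        calc ‖T ((2 / ‖w‖) • w)‖ = ‖T y + T ((2 / ‖w‖) • w - y)‖ := by rw [map_sub]; congr 1; abel
          _ ≤ ‖T y‖ + ‖T ((2 / ‖w‖) • w - y)‖ := norm_add_le _ _
          _ ≤ B + ‖T‖ * 1 := add_le_add (h1 y hy) ((T.le_opNorm _).trans
              (mul_le_mul_of_nonneg_left hd.le (norm_nonneg _)))
          _ = _ := by ring
      rw [map_smul, norm_smul, norm_div, norm_norm, Real.norm_ofNat] at h3
      rw [div_mul_eq_mul_div, le_div_iff₀ two_pos]
      rw [div_mul_eq_mul_div, div_le_iff₀ hw0] at h3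
      linarith
  linarith

lemma exp_le_add_exp_sq (x : ℝ) : Real.exp x ≤ x + Real.exp (x ^ 2) := by
  rcases le_or_gt |x| 1 with h | h
  · have h1 := (abs_le.1 (Real.abs_exp_sub_one_sub_id_le h)).2
    have h2 := Real.add_one_le_exp (x ^ 2)
    linarith
  · rcases lt_abs.1 h with h | h
    · have : Real.exp x ≤ Real.exp (x ^ 2) := Real.exp_le_exp.2 (by nlinarith)
      linarith
    · have h1 : Real.exp x ≤ 1 := Real.exp_le_one_iff.2 (by linarith)
      have h2 := Real.add_one_le_exp (x ^ 2)
      nlinarith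

/-- The values of a centred two-point variable all of whose moments of order at least two
are at least one. -/
noncomputable def skewVal (b : Bool) : ℝ := if b then 2 else -1

lemma skew_mgf_le (t : ℝ) :
    ∑ b, bernWeight (1 / 3) b * Real.exp (t * skewVal b) ≤ Real.exp (4 * t ^ 2) := by
  simp only [Fintype.sum_bool, bernWeight, skewVal, if_true, Bool.false_eq_true, if_false]
  have h1 := exp_le_add_exp_sq (t * 2)
  have h2 := exp_le_add_exp_sq (t * -1)
  have h3 : Real.exp ((t * -1) ^ 2) ≤ Real.exp (4 * t ^ 2) :=
    Real.exp_le_exp.2 (by nlinarith [sq_nonneg t])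
  have h4 : (t * 2) ^ 2 = 4 * t ^ 2 := by ring
  rw [h4] at h1
  linarith

lemma skew_moment_one {ι : Type*} (c : ι × ι) :
    entryMoment (fun _ _ => 1 / 3) (fun _ _ => skewVal) c 1 = 0 := by
  simp [entryMoment, bernWeight, skewVal]
  norm_num

lemma one_le_skew_moment {ι : Type*} (c : ι × ι) (m : ℕ) (hm : 2 ≤ m) :
    1 ≤ entryMoment (fun _ _ => 1 / 3) (fun _ _ => skewVal) c m := by
  simp only [entryMoment, bernWeight, skewVal, Fintype.sum_bool, if_true, Bool.false_eq_true,
    if_false]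
  rcases Nat.even_or_odd m with h | h
  · rw [h.neg_one_pow]
    have : (1 : ℝ) ≤ 2 ^ m := one_le_pow₀ (by norm_num)
    linarith
  · rw [h.neg_one_pow]
    have h3 : 3 ≤ m := by
      rcases h with ⟨j, rfl⟩
      omega
    have : (2 : ℝ) ^ 3 ≤ 2 ^ m := pow_le_pow_right₀ (by norm_num) h3
    linarith

lemma card_filter_sortedPair_le {ι : Type*} [Fintype ι] [LinearOrder ι] (c : ι × ι) :
    (Finset.univ.filter fun t : ι × ι => sortedPair t.1 t.2 = c).card ≤ 2 := by
  refine (Finset.card_le_card (t := {c, c.swap}) ?_).trans Finset.card_le_two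
  intro t ht
  have h : sortedPair t.1 t.2 = c := by simpa using ht
  rw [← h]
  unfold sortedPair
  rcases le_total t.1 t.2 with h | h
  · simp [h]
  · simp [h, Prod.swap]

lemma bernExp_exp_bilinear_le {r : ℕ} (x z : Fin r → ℝ) (s : ℝ) :
    bernExp (fun _ _ => 1 / 3) (fun ω => Real.exp (s * ∑ i, ∑ j, z i * x j *
      symmMat (fun _ _ => skewVal) ω i j)) ≤
      Real.exp (8 * s ^ 2 * ((∑ i, z i ^ 2) * ∑ j, x j ^ 2)) := by
  have h1 : (fun ω : Fin r → Fin r → Bool => Real.exp (s * ∑ i, ∑ j, z i * x j *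
      symmMat (fun _ _ => skewVal) ω i j)) = fun ω => ∏ t : Fin r × Fin r,
        Real.exp (s * (z t.1 * x t.2) *
          skewVal (ω (sortedPair t.1 t.2).1 (sortedPair t.1 t.2).2)) := by
    funext ω
    rw [← Real.exp_sum, Fintype.sum_prod_type, Finset.mul_sum]
    congr 1
    refine Finset.sum_congr rfl fun i _ => ?_
    rw [Finset.mul_sum]
    refine Finset.sum_congr rfl fun j _ => ?_
    simp only [symmMat, Matrix.of_apply, sortedPair]
    ring
  rw [h1, bernExp_prod_indicators (fun t : Fin r × Fin r => sortedPair t.1 t.2)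
    (fun t b => Real.exp (s * (z t.1 * x t.2) * skewVal b))]
  calc _ ≤ ∏ c : Fin r × Fin r, Real.exp (8 * ∑ t : Fin r × Fin r with sortedPair t.1 t.2 = c,
        (s * (z t.1 * x t.2)) ^ 2) := by
        refine Finset.prod_le_prod (fun c _ => Finset.sum_nonneg fun b _ => mul_nonneg
          (bernWeight_nonneg (by norm_num) (by norm_num) b)
          (Finset.prod_nonneg fun _ _ => (Real.exp_pos _).le)) fun c _ => ?_
        simp only [← Real.exp_sum, ← Finset.sum_mul]
        refine (skew_mgf_le _).trans (Real.exp_le_exp.2 ?_)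
        have h2 := sq_sum_le_card_mul_sum_sq
          (s := Finset.univ.filter fun t : Fin r × Fin r => sortedPair t.1 t.2 = c)
          (f := fun t => s * (z t.1 * x t.2))
        have h3 : ((Finset.univ.filter fun t : Fin r × Fin r =>
            sortedPair t.1 t.2 = c).card : ℝ) ≤ 2 := by
          exact_mod_cast card_filter_sortedPair_le c
        have h4 : 0 ≤ ∑ t : Fin r × Fin r with sortedPair t.1 t.2 = c,
            (s * (z t.1 * x t.2)) ^ 2 := Finset.sum_nonneg fun _ _ => sq_nonneg _
        nlinarith
    _ = Real.exp (8 * ∑ t : Fin r × Fin r, (s * (z t.1 * x t.2)) ^ 2) := by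
        rw [← Real.exp_sum, ← Finset.mul_sum, Finset.sum_fiberwise]
    _ = _ := by
        congr 1
        rw [Fintype.sum_prod_type, mul_assoc, Finset.sum_mul_sum]
        congr 1
        rw [Finset.mul_sum]
        refine Finset.sum_congr rfl fun i _ => ?_
        rw [Finset.mul_sum]
        exact Finset.sum_congr rfl fun j _ => by ring

lemma pow_mul_pow_le_factorial_mul_exp {s u v : ℝ} (hs : 0 ≤ s) (hu : 0 ≤ u) (huv : u ≤ v)
    (k : ℕ) : s ^ k * u ^ k ≤ k.factorial * Real.exp (s * v) := by
  have h1 := Real.pow_div_factorial_le_exp (s * u) (mul_nonneg hs hu) k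
  rw [div_le_iff₀ (Nat.cast_pos.2 k.factorial_pos), mul_pow, mul_comm (Real.exp _)] at h1
  refine h1.trans (mul_le_mul_of_nonneg_left ?_ (Nat.cast_nonneg _))
  exact Real.exp_le_exp.2 (mul_le_mul_of_nonneg_left huv hs)

lemma specNorm_pow_le_sum_exp {r : ℕ} (N : Finset (EuclideanSpace ℝ (Fin r)))
    (hN : ∀ x, ‖x‖ ≤ 2 → ∃ y ∈ N, ‖x - y‖ < 1) (M : Matrix (Fin r) (Fin r) ℝ) {s : ℝ}
    (hs : 0 ≤ s) (k : ℕ) :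
    s ^ k * specNorm M ^ k ≤ k.factorial *
      ∑ p ∈ N ×ˢ N, Real.exp (s * ∑ i, ∑ j, p.2 i * p.1 j * M i j) := by
  obtain ⟨x, hx, z, hz, hxz⟩ := exists_opNorm_le_inner N hN (Matrix.toEuclideanCLM (𝕜 := ℝ) M)
  rw [inner_toEuclideanCLM] at hxz
  have h0 : 0 ≤ specNorm M := norm_nonneg _
  have h1 := pow_mul_pow_le_factorial_mul_exp hs h0 hxz k
  refine h1.trans (mul_le_mul_of_nonneg_left ?_ (Nat.cast_nonneg _))
  have h2 : (x, z) ∈ N ×ˢ N := Finset.mk_mem_product hx hz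
  have h3 : ∀ p ∈ N ×ˢ N, 0 ≤ Real.exp (s * ∑ i, ∑ j, p.2 i * p.1 j * M i j) :=
    fun _ _ => (Real.exp_pos _).le
  have h4 := Finset.single_le_sum h3 h2
  simpa only using h4

lemma bernExp_skew_norm_pow_le (r q : ℕ) :
    (r : ℝ) ^ q * bernExp (fun _ _ : Fin r => 1 / 3)
      (fun ω => specNorm (symmMat (fun _ _ => skewVal) ω) ^ (2 * q)) ≤
      (2 * q).factorial * (25 * Real.exp 128) ^ r := by
  obtain ⟨N, hcard, hnorm, hnet⟩ := exists_net r
  have hr : (r : ℝ) ^ q = Real.sqrt r ^ (2 * q) := by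
    rw [pow_mul, Real.sq_sqrt (Nat.cast_nonneg r)]
  rw [hr, ← bernExp_const_mul]
  calc _ ≤ bernExp (fun _ _ : Fin r => 1 / 3) (fun ω => ((2 * q).factorial : ℝ) *
        ∑ p ∈ N ×ˢ N, Real.exp (Real.sqrt r * ∑ i, ∑ j, p.2 i * p.1 j *
          symmMat (fun _ _ => skewVal) ω i j)) := by
        refine bernExp_mono (by norm_num) (by norm_num) fun ω => ?_
        exact specNorm_pow_le_sum_exp N hnet _ (Real.sqrt_nonneg _) _
    _ ≤ (2 * q).factorial * ∑ p ∈ N ×ˢ N, Real.exp (128 * r) := by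
        rw [bernExp_const_mul, bernExp_sum]
        refine mul_le_mul_of_nonneg_left (Finset.sum_le_sum fun p hp => ?_) (by positivity)
        rw [Finset.mem_product] at hp
        refine (bernExp_exp_bilinear_le _ _ _).trans (Real.exp_le_exp.2 ?_)
        rw [Real.sq_sqrt (Nat.cast_nonneg r), ← EuclideanSpace.real_norm_sq_eq,
          ← EuclideanSpace.real_norm_sq_eq]
        have h1 : ‖p.1‖ ^ 2 ≤ 4 := by nlinarith [hnorm _ hp.1, norm_nonneg p.1]
        have h2 : ‖p.2‖ ^ 2 ≤ 4 := by nlinarith [hnorm _ hp.2, norm_nonneg p.2]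
        have h3 : ‖p.2‖ ^ 2 * ‖p.1‖ ^ 2 ≤ 4 * 4 := mul_le_mul h2 h1 (by positivity) (by norm_num)
        nlinarith [Nat.cast_nonneg (α := ℝ) r]
    _ ≤ _ := by
        refine mul_le_mul_of_nonneg_left ?_ (by positivity)
        rw [Finset.sum_const, nsmul_eq_mul, Finset.card_product, mul_pow, ← Real.exp_nat_mul,
          mul_comm (r : ℝ) 128]
        refine mul_le_mul_of_nonneg_right ?_ (Real.exp_pos _).le
        have : N.card * N.card ≤ 25 ^ r := by
          calc N.card * N.card ≤ 5 ^ r * 5 ^ r := Nat.mul_le_mul hcard hcard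
            _ = 25 ^ r := by
              rw [← mul_pow]
              norm_num
        exact_mod_cast this

/-- Moment bound for the centred symmetric Bernoulli matrix. -/
lemma bernExp_trace_centred_le {m : ℕ} {P : Fin m → Fin m → ℝ} (h0 : ∀ i j, 0 ≤ P i j)
    (h1 : ∀ i j, P i j ≤ 1) (hs : ∀ i j, P i j = P j i) {q : ℕ} (hq : 0 < q)
    (hd : ∀ i, ∑ j, P i j ≤ (2 * q : ℕ)) :
    bernExp P (fun ω => (symmMat (fun i j b => (if b then 1 else 0) - P i j) ω ^ (2 * q)).trace) ≤
      m * (q * (25 * Real.exp 128) ^ 4) ^ q := by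
  classical
  set L : ℝ := 25 * Real.exp 128 with hL
  have hm1 (c : Fin m × Fin m) :
      entryMoment P (fun i j b => (if b then 1 else 0) - P i j) c 1 = 0 := by
    simp [entryMoment, bernWeight]
    ring
  have hm2 (c : Fin m × Fin m) (k : ℕ) (hk : 2 ≤ k) :
      |entryMoment P (fun i j b => (if b then 1 else 0) - P i j) c k| ≤ P c.1 c.2 := by
    simp only [entryMoment, bernWeight, Fintype.sum_bool, if_true, Bool.false_eq_true, if_false]
    have hp0 := h0 c.1 c.2
    have hp1 := h1 c.1 c.2
    generalize P c.1 c.2 = p at hp0 hp1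
    have e1 : (1 - p) ^ k ≤ (1 - p) ^ 1 :=
      pow_le_pow_of_le_one (by linarith) (by linarith) (by omega)
    have e2 : p ^ k ≤ p ^ 1 := pow_le_pow_of_le_one (by linarith) (by linarith) (by omega)
    have e3 : p ^ k ≤ p ^ 2 := pow_le_pow_of_le_one (by linarith) (by linarith) (by omega)
    have e4 : (1 - p) ^ k ≤ (1 - p) ^ 2 :=
      pow_le_pow_of_le_one (by linarith) (by linarith) (by omega)
    calc |p * (1 - p) ^ k + (1 - p) * (0 - p) ^ k|
        ≤ |p * (1 - p) ^ k| + |(1 - p) * (0 - p) ^ k| := abs_add_le _ _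
      _ = p * (1 - p) ^ k + (1 - p) * p ^ k := by
          rw [abs_mul, abs_mul, abs_pow, abs_pow, zero_sub, abs_neg, abs_of_nonneg hp0,
            abs_of_nonneg (by linarith : 0 ≤ 1 - p)]
      _ ≤ p * (1 - p) ^ 2 + (1 - p) * p ^ 2 := by
          gcongr
      _ ≤ p := by nlinarith
  have hW : Fintype.card (Fin (4 * q)) = 4 * q := Fintype.card_fin _
  have hq' : (0 : ℝ) < q := by exact_mod_cast hq
  have key : (4 * q : ℝ) ^ q * bernExp (fun _ _ : Fin (4 * q) => 1 / 3)
      (fun ω => specNorm (symmMat (fun _ _ => skewVal) ω) ^ (2 * q)) ≤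
      (4 * q : ℝ) ^ q * (q * L ^ 4) ^ q := by
    have := bernExp_skew_norm_pow_le (4 * q) q
    push_cast at this
    refine this.trans ?_
    have hf : ((2 * q).factorial : ℝ) ≤ (2 * q : ℝ) ^ (2 * q) := by
      exact_mod_cast Nat.factorial_le_pow (2 * q)
    calc _ ≤ (2 * q : ℝ) ^ (2 * q) * L ^ (4 * q) :=
          mul_le_mul_of_nonneg_right hf (by positivity)
      _ = _ := by
          rw [pow_mul, pow_mul L, ← mul_pow, ← mul_pow]
          congr 1
          ring
  have key2 := le_of_mul_le_mul_left key (by positivity)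
  calc _ ≤ _ := bernExp_trace_pow_le h1 hs hm1 hm2 (2 * q)
    _ ≤ _ := sum_discoveryWeight_le_card (W := Fin (4 * q)) h0 (ρ := 2 * q) (by omega)
        hd (by rw [hW]; omega) IsGoodWalk IsGoodWalk isGoodWalk_of_samePattern
    _ ≤ _ := mul_le_mul_of_nonneg_left (le_bernExp_trace_pow skew_moment_one one_le_skew_moment _)
        (by positivity)
    _ ≤ (Fintype.card (Fin m) : ℝ) / Fintype.card (Fin (4 * q)) *
        bernExp (fun _ _ : Fin (4 * q) => 1 / 3) (fun ω => ((4 * q : ℕ) : ℝ) *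
          specNorm (symmMat (fun _ _ => skewVal) ω) ^ (2 * q)) :=
        mul_le_mul_of_nonneg_left
          (bernExp_mono (by norm_num) (by norm_num) fun ω => trace_pow_le _ _) (by positivity)
    _ ≤ (Fintype.card (Fin m) : ℝ) / Fintype.card (Fin (4 * q)) *
        (((4 * q : ℕ) : ℝ) * (q * L ^ 4) ^ q) := by
        rw [bernExp_const_mul]
        gcongr
    _ = _ := by
        rw [hW, Fintype.card_fin]
        push_cast
        field_simp

/-- The spectral norm of a centred symmetric Bernoulli matrix with row sums at most `d` is
`O(√d)`. -/
lemma exists_specNorm_bound : ∃ K : ℝ, 1 ≤ K ∧ ∀ (m : ℕ) (P : Fin m → Fin m → ℝ) (d : ℝ),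
    (∀ i j, 0 ≤ P i j) → (∀ i j, P i j ≤ 1) → (∀ i j, P i j = P j i) → 1 ≤ d →
    (∀ i, ∑ j, P i j ≤ d) →
    bernExp P (Set.indicator {ω | K * Real.sqrt d < specNorm (adjOf ω - Matrix.of P)} 1) ≤
      m * Real.exp (-d) := by
  set L : ℝ := 25 * Real.exp 128 with hL
  have hL1 : 1 ≤ L := by
    have := Real.one_le_exp (x := 128) (by norm_num)
    linarith
  refine ⟨Real.exp 1 * L ^ 2, ?_, ?_⟩
  · have h1 := Real.one_le_exp (x := 1) (by norm_num)
    have h2 : 1 ≤ L ^ 2 := one_le_pow₀ hL1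
    nlinarith
  intro m P d h0 h1 hs hd1 hd
  obtain ⟨l, hl1, hl2⟩ := exists_nat_pow_near hd1 (one_lt_two : (1 : ℝ) < 2)
  set q : ℕ := 2 ^ l with hq
  have hq1 : (q : ℝ) ≤ d := by simpa [hq] using hl1
  have hq2 : d ≤ 2 * q := by
    have : (2 : ℝ) ^ (l + 1) = 2 * q := by
      rw [hq]
      push_cast
      ring
    linarith
  have hqpos : 0 < q := by positivity
  have hX (ω : Fin m → Fin m → Bool) : symmMat (fun i j b => (if b then 1 else 0) - P i j) ω =
      adjOf ω - Matrix.of P := by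
    ext i j
    simp only [symmMat, adjOf, Matrix.of_apply, Matrix.sub_apply]
    by_cases h : i ≤ j
    · simp [h]
    · have h' := (not_le.1 h).le
      simp only [min_eq_right h', max_eq_left h', if_neg h, hs i j]
  have hXs (ω : Fin m → Fin m → Bool) : (adjOf ω - Matrix.of P)ᵀ = adjOf ω - Matrix.of P := by
    rw [← hX]
    ext i j
    simp only [symmMat, Matrix.of_apply, Matrix.transpose_apply, min_comm, max_comm]
  set t : ℝ := Real.exp 1 * L ^ 2 * Real.sqrt d with ht
  have htpos : 0 < t := by positivity
  have hmain := bernExp_trace_centred_le h0 h1 hs hqpos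
    (fun i => (hd i).trans (by push_cast; exact hq2))
  calc _ ≤ bernExp P (fun ω => (t ^ (2 * q))⁻¹ *
        (symmMat (fun i j b => (if b then 1 else 0) - P i j) ω ^ (2 * q)).trace) := by
        have hnn (ω : Fin m → Fin m → Bool) : specNorm (adjOf ω - Matrix.of P) ^ (2 * q) ≤
            (symmMat (fun i j b => (if b then 1 else 0) - P i j) ω ^ (2 * q)).trace := by
          rw [hX, hq, ← pow_succ']
          exact specNorm_pow_le_trace (hXs ω) l
        refine bernExp_indicator_le h0 h1 _ _ (fun ω => ?_) fun ω hω => ?_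
        · have h2 : 0 ≤ specNorm (adjOf ω - Matrix.of P) := norm_nonneg _
          exact mul_nonneg (by positivity) ((by positivity : (0 : ℝ) ≤ _).trans (hnn ω))
        · have hω' : t < specNorm (adjOf ω - Matrix.of P) := hω
          rw [inv_mul_eq_div, one_le_div (by positivity)]
          exact (pow_le_pow_left₀ htpos.le hω'.le _).trans (hnn ω)
    _ ≤ (t ^ (2 * q))⁻¹ * (m * (q * L ^ 4) ^ q) := by
        rw [bernExp_const_mul]
        gcongr
    _ ≤ (t ^ (2 * q))⁻¹ * (m * (d * L ^ 4) ^ q) := by gcongr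
    _ = m * Real.exp (-(2 * q)) := by
        have e1 : t ^ (2 * q) = Real.exp (2 * q) * (d * L ^ 4) ^ q := by
          rw [pow_mul, ht]
          have : (Real.exp 1 * L ^ 2 * Real.sqrt d) ^ 2 = Real.exp 2 * (d * L ^ 4) := by
            rw [mul_pow, mul_pow, Real.sq_sqrt (by linarith), ← Real.exp_nat_mul]
            norm_num
            ring
          rw [this, mul_pow, ← Real.exp_nat_mul, mul_comm (q : ℝ) 2]
        rw [e1, Real.exp_neg]
        field_simp
    _ ≤ _ := by
        gcongr

lemma exp_neg_one_le_decimal : Real.exp (-1) ≤ 0.37 := by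
  have := Real.exp_neg_one_lt_d9
  linarith

/-- Lower tail bound for a sum of distinct edge indicators. -/
lemma bernExp_lower_tail {ι J : Type*} [Fintype ι] [DecidableEq ι] [Fintype J]
    {P : ι → ι → ℝ} (h0 : ∀ i j, 0 ≤ P i j) (h1 : ∀ i j, P i j ≤ 1) (e : J → ι × ι)
    (he : Function.Injective e) :
    bernExp P (Set.indicator {ω | ∑ t, (if ω (e t).1 (e t).2 then 1 else 0 : ℝ) <
      0.1 * ∑ t, P (e t).1 (e t).2} 1) ≤ Real.exp (-(0.53 * ∑ t, P (e t).1 (e t).2)) := by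
  classical
  set S := ∑ t, P (e t).1 (e t).2 with hS
  have hmgf : bernExp P (fun ω => ∏ t, Real.exp (-(if ω (e t).1 (e t).2 then 1 else 0))) ≤
      Real.exp (-(0.63 * S)) := by
    rw [bernExp_prod_indicators e (fun _ b => Real.exp (-(if b then 1 else 0)))]
    calc _ ≤ ∏ c : ι × ι, Real.exp (∑ t with e t = c, -(0.63 * P (e t).1 (e t).2)) := by
          refine Finset.prod_le_prod (fun c _ => Finset.sum_nonneg fun b _ => mul_nonneg
            (bernWeight_nonneg (h0 _ _) (h1 _ _) b)
            (Finset.prod_nonneg fun _ _ => (Real.exp_pos _).le)) fun c _ => ?_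
          by_cases hc : ∃ t, e t = c
          · obtain ⟨t, rfl⟩ := hc
            have hf : (Finset.univ.filter fun t' => e t' = e t) = {t} := by
              ext t'
              simp [he.eq_iff]
            rw [hf]
            simp only [Finset.prod_singleton, Finset.sum_singleton, Fintype.sum_bool, bernWeight,
              if_true, Bool.false_eq_true, if_false, neg_zero, Real.exp_zero]
            have h2 := Real.add_one_le_exp (-(0.63 * P (e t).1 (e t).2))
            have h3 := exp_neg_one_le_decimal
            nlinarith [h0 (e t).1 (e t).2]
          · have hf : (Finset.univ.filter fun t' => e t' = c) = ∅ := by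
              ext t'
              simpa using fun h => hc ⟨t', h⟩
            rw [hf]
            simp only [Finset.prod_empty, Finset.sum_empty, Real.exp_zero, mul_one]
            exact (sum_bernWeight _).le
      _ = _ := by
          rw [← Real.exp_sum, Finset.sum_fiberwise, Finset.sum_neg_distrib, ← Finset.mul_sum]
  calc _ ≤ bernExp P (fun ω => Real.exp (0.1 * S) *
        ∏ t, Real.exp (-(if ω (e t).1 (e t).2 then 1 else 0))) := by
        refine bernExp_indicator_le h0 h1 _ _ (fun ω => by positivity) fun ω hω => ?_
        have hω' : ∑ t, (if ω (e t).1 (e t).2 then 1 else 0 : ℝ) < 0.1 * S := hω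
        rw [← Real.exp_sum, ← Real.exp_add, Finset.sum_neg_distrib]
        exact Real.one_le_exp (by linarith)
    _ ≤ Real.exp (0.1 * S) * Real.exp (-(0.63 * S)) := by
        rw [bernExp_const_mul]
        gcongr
    _ = _ := by
        rw [← Real.exp_add]
        congr 1
        ring

lemma adjOf_eq_sortedPair {m : ℕ} (ω : Fin m → Fin m → Bool) (i j : Fin m) :
    adjOf ω i j = if ω (sortedPair i j).1 (sortedPair i j).2 then 1 else 0 := by
  simp only [adjOf, Matrix.of_apply, sortedPair]
  by_cases h : i ≤ j
  · simp [h]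
  · have h' := (not_le.1 h).le
    simp only [min_eq_right h', max_eq_left h', if_neg h]

lemma card_val_lt (n : ℕ) : (Finset.univ.filter fun j : Fin (2 * n) => j.val < n).card = n := by
  rw [Finset.card_filter, Fin.sum_univ_eq_sum_range (fun j => if j < n then 1 else 0),
    ← Finset.card_filter]
  have : (Finset.range (2 * n)).filter (fun j => j < n) = Finset.range n := by
    ext j
    simp only [Finset.mem_filter, Finset.mem_range]
    omega
  rw [this, Finset.card_range]

lemma card_val_not_lt (n : ℕ) :
    (Finset.univ.filter fun j : Fin (2 * n) => ¬ j.val < n).card = n := by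
  have := Finset.card_filter_add_card_filter_not (s := (Finset.univ : Finset (Fin (2 * n))))
    (fun j => j.val < n)
  rw [card_val_lt, Finset.card_univ, Fintype.card_fin] at this
  omega

lemma card_val_lt_iff {n : ℕ} (i : Fin (2 * n)) :
    (Finset.univ.filter fun j : Fin (2 * n) => (i.val < n ↔ j.val < n)).card = n := by
  by_cases h : i.val < n
  · simpa [h] using card_val_lt n
  · simpa [h] using card_val_not_lt n

lemma card_not_val_lt_iff {n : ℕ} (i : Fin (2 * n)) :
    (Finset.univ.filter fun j : Fin (2 * n) => ¬ (i.val < n ↔ j.val < n)).card = n := by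
  by_cases h : i.val < n
  · simpa [h] using card_val_not_lt n
  · simpa [h] using card_val_lt n

lemma sum_sbmProb {n : ℕ} (hn : 0 < n) (a b : ℝ) (i : Fin (2 * n)) :
    ∑ j, sbmProb n (a / n) (b / n) i j = a + b := by
  have hn' : (n : ℝ) ≠ 0 := by positivity
  simp only [sbmProb]
  rw [Finset.sum_ite, Finset.sum_const, Finset.sum_const, card_val_lt_iff, card_not_val_lt_iff,
    nsmul_eq_mul, nsmul_eq_mul]
  field_simp

/-- The properties of the random graph used in the deterministic part of the argument. -/
def IsTypical (n : ℕ) (a b K : ℝ) (ω : Fin (2 * n) → Fin (2 * n) → Bool) : Prop :=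
  specNorm (adjOf ω - Bmat n a b) ≤ K * Real.sqrt (a + b) ∧
  (∀ i : Fin (2 * n), 0.1 * a ≤
    ∑ j ∈ Finset.univ.filter (fun j : Fin (2 * n) => (i.val < n ↔ j.val < n)), adjOf ω i j) ∧
  ∃ i j : Fin (2 * n), i.val < n ∧ ¬ j.val < n ∧ adjOf ω i j = 1

lemma sbmProb_comm {n : ℕ} (p q : ℝ) (i j : Fin (2 * n)) :
    sbmProb n p q i j = sbmProb n p q j i := by
  unfold sbmProb
  simp only [iff_comm]

lemma bernExp_inDegree_lower_tail {n : ℕ} (hn : 0 < n) {a b : ℝ} (ha0 : 0 ≤ a) (ha1 : a ≤ n)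
    (hb0 : 0 ≤ b) (hb1 : b ≤ n) (i : Fin (2 * n)) :
    bernExp (sbmProb n (a / n) (b / n)) (Set.indicator {ω | ∑ j ∈ Finset.univ.filter
      (fun j : Fin (2 * n) => (i.val < n ↔ j.val < n)), adjOf ω i j < 0.1 * a} 1) ≤
      Real.exp (-(0.53 * a)) := by
  have hn' : (0 : ℝ) < n := by positivity
  have h0 (i j : Fin (2 * n)) : 0 ≤ sbmProb n (a / n) (b / n) i j := by
    unfold sbmProb
    split_ifs <;> positivity
  have h1 (i j : Fin (2 * n)) : sbmProb n (a / n) (b / n) i j ≤ 1 := by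
    unfold sbmProb
    split_ifs <;> rw [div_le_one hn'] <;> assumption
  let J := {j : Fin (2 * n) // i.val < n ↔ j.val < n}
  have h := bernExp_lower_tail h0 h1 (fun t : J => sortedPair i t.1) (by
    intro s t hst
    rcases sortedPair_eq_iff.1 hst with h | h
    · exact Subtype.ext h.2
    · exact Subtype.ext (h.2.trans h.1))
  have hS : ∑ t : J, sbmProb n (a / n) (b / n) (sortedPair i t.1).1 (sortedPair i t.1).2 = a := by
    have : ∀ t : J, sbmProb n (a / n) (b / n) (sortedPair i t.1).1 (sortedPair i t.1).2 =
        a / n := by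
      intro t
      unfold sortedPair
      rcases le_total i t.1 with h | h
      · rw [min_eq_left h, max_eq_right h]
        exact if_pos t.2
      · rw [min_eq_right h, max_eq_left h]
        exact if_pos t.2.symm
    rw [Finset.sum_congr rfl fun t _ => this t, Finset.sum_const, Finset.card_univ,
      Fintype.card_subtype, card_val_lt_iff, nsmul_eq_mul]
    field_simp
  rw [hS] at h
  convert h using 5 with ω
  simp only [← adjOf_eq_sortedPair]
  rw [Finset.sum_subtype (p := fun j : Fin (2 * n) => i.val < n ↔ j.val < n) _ (by simp)]

lemma bernExp_no_crossing {n : ℕ} (hn : 0 < n) {a b : ℝ} (ha0 : 0 ≤ a) (ha1 : a ≤ n)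
    (hb0 : 1 ≤ b) (hb1 : b ≤ n) :
    bernExp (sbmProb n (a / n) (b / n)) (Set.indicator {ω | ¬ ∃ i j : Fin (2 * n),
      i.val < n ∧ ¬ j.val < n ∧ adjOf ω i j = 1} 1) ≤ Real.exp (-(0.53 * n)) := by
  have hn' : (0 : ℝ) < n := by positivity
  have h0 (i j : Fin (2 * n)) : 0 ≤ sbmProb n (a / n) (b / n) i j := by
    unfold sbmProb
    split_ifs <;> positivity
  have h1 (i j : Fin (2 * n)) : sbmProb n (a / n) (b / n) i j ≤ 1 := by
    unfold sbmProb
    split_ifs <;> rw [div_le_one hn'] <;> assumption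
  let J := {j : Fin (2 * n) // j.val < n} × {j : Fin (2 * n) // ¬ j.val < n}
  have hS : ∑ t : J, sbmProb n (a / n) (b / n) t.1.1 t.2.1 = n * b := by
    have : ∀ t : J, sbmProb n (a / n) (b / n) t.1.1 t.2.1 = b / n := by
      intro t
      exact if_neg (by simp [t.1.2, t.2.2])
    rw [Finset.sum_congr rfl fun t _ => this t, Finset.sum_const, Finset.card_univ,
      Fintype.card_prod, Fintype.card_subtype, Fintype.card_subtype, card_val_lt,
      card_val_not_lt, nsmul_eq_mul]
    push_cast
    field_simp
  have h := bernExp_lower_tail h0 h1 (fun t : J => (t.1.1, t.2.1)) (by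
    rintro ⟨s1, s2⟩ ⟨t1, t2⟩ h
    rw [Prod.mk.injEq] at h
    exact Prod.ext (Subtype.ext h.1) (Subtype.ext h.2))
  simp only at h
  rw [hS] at h
  have hle : Real.exp (-(0.53 * (n * b))) ≤ Real.exp (-(0.53 * n)) :=
    Real.exp_le_exp.2 (by nlinarith)
  refine (bernExp_mono h0 h1 fun ω => ?_).trans (h.trans hle)
  refine Set.indicator_le_indicator_of_subset (fun ω hω => ?_) (fun _ => zero_le_one) ω
  simp only [Set.mem_ofPred_eq, not_exists, not_and] at hω ⊢
  rw [Finset.sum_eq_zero]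
  · positivity
  · intro t _
    have := hω t.1.1 t.2.1 t.1.2 t.2.2
    have hle : t.1.1 ≤ t.2.1 := by
      have := t.1.2
      have := t.2.2
      rw [Fin.le_def]
      omega
    simp only [adjOf, Matrix.of_apply, if_pos hle] at this
    simpa using this

lemma exists_sbm_typical_ge : ∃ K : ℝ, 1 ≤ K ∧ ∃ N0 : ℕ, ∀ n : ℕ, N0 ≤ n → ∀ a b : ℝ,
    1 ≤ b → b ≤ a → 5 * Real.log n < a + b → a + b ≤ n →
    ENNReal.ofReal (1 - (n : ℝ) ^ (-(1 / 4 : ℝ))) ≤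
      sbm n (a / n) (b / n) {ω | IsTypical n a b K ω} := by
  obtain ⟨K, hK1, hK⟩ := exists_specNorm_bound
  have hlim : ∀ᶠ n : ℕ in Filter.atTop, (5 : ℝ) ≤ (n : ℝ) ^ (0.075 : ℝ) :=
    ((tendsto_rpow_atTop (by norm_num : (0 : ℝ) < 0.075)).comp
      tendsto_natCast_atTop_atTop).eventually_ge_atTop 5
  obtain ⟨N1, hN1⟩ := Filter.eventually_atTop.1 hlim
  refine ⟨K, hK1, max N1 1, fun n hn a b hb1 hab hlog hdn => ?_⟩
  have hn0 : 0 < n := (le_max_right _ _).trans hn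
  have hn5 := hN1 n ((le_max_left _ _).trans hn)
  have hn' : (0 : ℝ) < n := by positivity
  have ha0 : 0 ≤ a := by linarith
  have hb0 : 0 ≤ b := by linarith
  have ha1 : a ≤ n := by linarith
  have hbn : b ≤ n := by linarith
  have h0 (i j : Fin (2 * n)) : 0 ≤ sbmProb n (a / n) (b / n) i j := by
    unfold sbmProb
    split_ifs <;> positivity
  have h1 (i j : Fin (2 * n)) : sbmProb n (a / n) (b / n) i j ≤ 1 := by
    unfold sbmProb
    split_ifs <;> rw [div_le_one hn'] <;> assumption
  have hnorm := hK (2 * n) _ (a + b) h0 h1 (sbmProb_comm _ _) (by linarith)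
    (fun i => (sum_sbmProb hn0 a b i).le)
  have hdeg := bernExp_inDegree_lower_tail hn0 ha0 ha1 hb0 hbn
  have hcross := bernExp_no_crossing hn0 ha0 ha1 hb1 hbn
  rw [sbm_apply (by positivity) ((div_le_one hn').2 ha1) (by positivity) ((div_le_one hn').2 hbn)]
  refine ENNReal.ofReal_le_ofReal ?_
  set T : Set (Fin (2 * n) → Fin (2 * n) → Bool) := {ω | IsTypical n a b K ω} with hT
  set P := sbmProb n (a / n) (b / n) with hP
  set S1 : Set (Fin (2 * n) → Fin (2 * n) → Bool) :=
    {ω | K * Real.sqrt (a + b) < specNorm (adjOf ω - Matrix.of P)} with hS1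
  set S2 : Fin (2 * n) → Set (Fin (2 * n) → Fin (2 * n) → Bool) := fun i =>
    {ω | ∑ j ∈ Finset.univ.filter
      (fun j : Fin (2 * n) => (i.val < n ↔ j.val < n)), adjOf ω i j < 0.1 * a} with hS2
  set S3 : Set (Fin (2 * n) → Fin (2 * n) → Bool) := {ω | ¬ ∃ i j : Fin (2 * n),
      i.val < n ∧ ¬ j.val < n ∧ adjOf ω i j = 1} with hS3
  have hBP : Bmat n a b = Matrix.of P := rfl
  have hcover (ω : Fin (2 * n) → Fin (2 * n) → Bool) : (1 : ℝ) ≤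
      T.indicator 1 ω + (S1.indicator 1 ω + ((∑ i, (S2 i).indicator 1 ω) + S3.indicator 1 ω)) := by
    have n1 (U : Set (Fin (2 * n) → Fin (2 * n) → Bool)) : (0 : ℝ) ≤ U.indicator 1 ω :=
      Set.indicator_nonneg (fun _ _ => zero_le_one) ω
    have n2 : (0 : ℝ) ≤ ∑ i, (S2 i).indicator 1 ω := Finset.sum_nonneg fun i _ => n1 _
    have e1 {U : Set (Fin (2 * n) → Fin (2 * n) → Bool)} (h : ω ∈ U) :
        U.indicator (1 : (Fin (2 * n) → Fin (2 * n) → Bool) → ℝ) ω = 1 := by simp [h]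
    by_cases c1 : ω ∈ S1
    · linarith [e1 c1, n1 T, n1 S3]
    by_cases c3 : ω ∈ S3
    · linarith [e1 c3, n1 T, n1 S1]
    by_cases c2 : ∃ i, ω ∈ S2 i
    · obtain ⟨i, hi⟩ := c2
      have := Finset.single_le_sum (f := fun i => (S2 i).indicator (1 : (Fin (2 * n) → Fin (2 * n) → Bool) → ℝ) ω)
        (fun j _ => n1 (S2 j)) (Finset.mem_univ i)
      linarith [e1 hi, n1 T, n1 S1, n1 S3]
    · have : ω ∈ T := by
        refine ⟨?_, fun i => ?_, ?_⟩
        · rw [hBP]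
          exact not_lt.1 c1
        · exact not_lt.1 fun h => c2 ⟨i, h⟩
        · exact not_not.1 c3
      linarith [e1 this, n1 S1, n1 S3]
  have hadd (f g : (Fin (2 * n) → Fin (2 * n) → Bool) → ℝ) :
      bernExp P (fun ω => f ω + g ω) = bernExp P f + bernExp P g := by
    simp only [bernExp, mul_add, Finset.sum_add_distrib]
  have htotal := bernExp_mono h0 h1 hcover
  rw [bernExp_const, hadd, hadd, hadd, bernExp_sum] at htotal
  have hsum : ∑ i, bernExp P ((S2 i).indicator 1) ≤ 2 * n * Real.exp (-(0.53 * a)) := by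
    refine (Finset.sum_le_sum fun i _ => hdeg i).trans (le_of_eq ?_)
    simp
  have hexp {t : ℝ} (s : ℝ) (h : s * Real.log n ≤ t) : Real.exp (-t) ≤ (n : ℝ) ^ (-s) := by
    rw [Real.rpow_def_of_pos hn']
    exact Real.exp_le_exp.2 (by linarith)
  have hl0 : 0 ≤ Real.log n := Real.log_natCast_nonneg n
  have hln : Real.log n ≤ n := (Real.log_le_sub_one_of_pos hn').trans (by linarith)
  have b1 := hexp 1.325 (t := a + b) (by linarith)
  have b2 := hexp 1.325 (t := 0.53 * a) (by linarith)
  have b3 := hexp 0.325 (t := 0.53 * n) (by linarith)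
  have c1 : (n : ℝ) * (n : ℝ) ^ (-1.325 : ℝ) = (n : ℝ) ^ (-0.325 : ℝ) := by
    rw [mul_comm, ← Real.rpow_add_one hn'.ne']
    norm_num
  have c2 : (n : ℝ) ^ (0.075 : ℝ) * (n : ℝ) ^ (-0.325 : ℝ) = (n : ℝ) ^ (-(1 / 4) : ℝ) := by
    rw [← Real.rpow_add hn']
    norm_num
  have c3 : 5 * (n : ℝ) ^ (-0.325 : ℝ) ≤ (n : ℝ) ^ (-(1 / 4) : ℝ) := by
    rw [← c2]
    gcongr
  have d1 := mul_le_mul_of_nonneg_left b1 hn'.le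
  have d2 := mul_le_mul_of_nonneg_left b2 hn'.le
  push_cast at hnorm
  rw [c1] at d1 d2
  linarith

lemma exists_eigenbasis {m : ℕ} {H : Matrix (Fin m) (Fin m) ℝ} (hH : H.IsHermitian)
    (σ : Equiv.Perm (Fin m)) : ∃ f : Fin m → Fin m → ℝ,
      (∀ k l, f k ⬝ᵥ f l = if k = l then 1 else 0) ∧
      (∀ k, H *ᵥ f k = (hH.eigenvalues ∘ σ) k • f k) ∧
      ∀ x y : Fin m → ℝ, x ⬝ᵥ y = ∑ k, (x ⬝ᵥ f k) * (y ⬝ᵥ f k) := by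
  have hinner (x y : EuclideanSpace ℝ (Fin m)) : inner ℝ x y = x.ofLp ⬝ᵥ y.ofLp := by
    rw [EuclideanSpace.inner_eq_star_dotProduct, star_trivial, dotProduct_comm]
  refine ⟨fun k => (hH.eigenvectorBasis (σ k)).ofLp, fun k l => ?_, fun k => ?_, fun x y => ?_⟩
  · rw [← hinner, hH.eigenvectorBasis.inner_eq_ite]
    simp only [σ.injective.eq_iff]
  · exact hH.mulVec_eigenvectorBasis (σ k)
  · have h := hH.eigenvectorBasis.sum_inner_mul_inner (WithLp.toLp 2 x) (WithLp.toLp 2 y)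
    rw [← Equiv.sum_comp σ] at h
    simp only [hinner] at h
    rw [← h]
    exact Finset.sum_congr rfl fun k _ => by rw [dotProduct_comm y]

lemma IsHermitian.mulVec_dotProduct_comm {m : ℕ} {H : Matrix (Fin m) (Fin m) ℝ}
    (hH : H.IsHermitian) (x y : Fin m → ℝ) : (H *ᵥ x) ⬝ᵥ y = x ⬝ᵥ (H *ᵥ y) := by
  have hT : Hᵀ = H := by simpa [Matrix.IsHermitian, conjTranspose_eq_transpose_of_trivial] using hH
  rw [dotProduct_mulVec, ← mulVec_transpose, hT]

/-- The third eigenvalue is bounded by the quadratic form on a subspace of codimension two. -/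
lemma eigenvalue_le_of_codim_two {m : ℕ} {H : Matrix (Fin m) (Fin m) ℝ} {f : Fin m → Fin m → ℝ}
    {lam : Fin m → ℝ} (hf : ∀ k l, f k ⬝ᵥ f l = if k = l then 1 else 0)
    (hev : ∀ k, H *ᵥ f k = lam k • f k) {p q : Fin m → ℝ} {θ : ℝ}
    (hθ : ∀ x, x ⬝ᵥ p = 0 → x ⬝ᵥ q = 0 → x ⬝ᵥ (H *ᵥ x) ≤ θ * (x ⬝ᵥ x))
    {i j k : Fin m} (hij : i ≠ j) (hik : i ≠ k) (hjk : j ≠ k) (hki : lam k ≤ lam i)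
    (hkj : lam k ≤ lam j) : lam k ≤ θ := by
  let T : Matrix (Fin 2) (Fin 3) ℝ :=
    !![f i ⬝ᵥ p, f j ⬝ᵥ p, f k ⬝ᵥ p; f i ⬝ᵥ q, f j ⬝ᵥ q, f k ⬝ᵥ q]
  obtain ⟨α, hα, hα0⟩ := Submodule.exists_mem_ne_zero_of_ne_bot
    (LinearMap.ker_ne_bot_of_finrank_lt (f := T.mulVecLin) (by simp))
  have hT : T *ᵥ α = 0 := by simpa using hα
  have e1 := congrFun hT 0
  have e2 := congrFun hT 1
  simp only [T, Matrix.mulVec, dotProduct, Fin.sum_univ_three, Matrix.of_apply, Matrix.cons_val',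
    Matrix.cons_val_zero, Matrix.cons_val_one, Matrix.cons_val, Pi.zero_apply] at e1 e2
  set x := α 0 • f i + α 1 • f j + α 2 • f k with hx
  have hx2 : x ⬝ᵥ x = α 0 ^ 2 + α 1 ^ 2 + α 2 ^ 2 := by
    simp only [hx, add_dotProduct, dotProduct_add, smul_dotProduct, dotProduct_smul, hf, hij, hik,
      hjk, hij.symm, hik.symm, hjk.symm, if_true, if_false, smul_eq_mul]
    ring
  have hHx : x ⬝ᵥ (H *ᵥ x) = lam i * α 0 ^ 2 + lam j * α 1 ^ 2 + lam k * α 2 ^ 2 := by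
    simp only [hx, mulVec_add, mulVec_smul, hev, add_dotProduct, dotProduct_add, smul_dotProduct,
      dotProduct_smul, hf, hij, hik, hjk, hij.symm, hik.symm, hjk.symm, if_true, if_false,
      smul_eq_mul]
    ring
  have hpos : 0 < x ⬝ᵥ x := by
    rw [hx2]
    by_contra hcon
    refine hα0 (funext fun t => ?_)
    have h0 : α 0 = 0 := by nlinarith [sq_nonneg (α 0), sq_nonneg (α 1), sq_nonneg (α 2)]
    have h1 : α 1 = 0 := by nlinarith [sq_nonneg (α 0), sq_nonneg (α 1), sq_nonneg (α 2)]
    have h2 : α 2 = 0 := by nlinarith [sq_nonneg (α 0), sq_nonneg (α 1), sq_nonneg (α 2)]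
    fin_cases t <;> assumption
  have hb := hθ x (by
      simp only [hx, add_dotProduct, smul_dotProduct, smul_eq_mul]
      simp only [dotProduct]
      linarith) (by
      simp only [hx, add_dotProduct, smul_dotProduct, smul_eq_mul]
      simp only [dotProduct]
      linarith)
  rw [hHx] at hb
  have : lam k * (x ⬝ᵥ x) ≤ θ * (x ⬝ᵥ x) := by
    refine le_trans ?_ hb
    rw [hx2]
    nlinarith [sq_nonneg (α 0), sq_nonneg (α 1), sq_nonneg (α 2)]
  exact le_of_mul_le_mul_right this hpos

/-- An approximate eigenvector `v` that is nearly orthogonal to the top eigenvector `u` is close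
to the span of any unit second eigenvector. -/
lemma norm_sq_sub_inner_sq_le {m : ℕ} {H : Matrix (Fin m) (Fin m) ℝ} (hH : H.IsHermitian)
    {lam : Fin m → ℝ} {σ : Equiv.Perm (Fin m)} (hlam : lam = hH.eigenvalues ∘ σ)
    (hanti : Antitone lam) {i : Fin m} (hi : i.val = 1)
    (hle : ∀ x, x ⬝ᵥ (H *ᵥ x) ≤ x ⬝ᵥ x) {u : Fin m → ℝ} (hu0 : u ≠ 0) (hu : H *ᵥ u = u)
    (huniq : ∀ x, H *ᵥ x = x → ∃ t : ℝ, x = t • u) {p q : Fin m → ℝ} {θ μ η ρ : ℝ}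
    (hθ : ∀ x, x ⬝ᵥ p = 0 → x ⬝ᵥ q = 0 → x ⬝ᵥ (H *ᵥ x) ≤ θ * (x ⬝ᵥ x)) (hμ : 0 < μ)
    (hθμ : θ ≤ μ / 2) {v : Fin m → ℝ}
    (hη : (H *ᵥ v - μ • v) ⬝ᵥ (H *ᵥ v - μ • v) ≤ η) (hρ : (v ⬝ᵥ u) ^ 2 ≤ ρ * (u ⬝ᵥ u))
    (hlt : 4 * η / μ ^ 2 + ρ < v ⬝ᵥ v) {w : Fin m → ℝ} (hw : H *ᵥ w = lam i • w)
    (hw1 : w ⬝ᵥ w = 1) : v ⬝ᵥ v - (v ⬝ᵥ w) ^ 2 ≤ 4 * η / μ ^ 2 + ρ := by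
  classical
  obtain ⟨f, hf, hev, hpar⟩ := exists_eigenbasis hH σ
  rw [← hlam] at hev
  have hcoef (x : Fin m → ℝ) (k : Fin m) : (H *ᵥ x) ⬝ᵥ f k = lam k * (x ⬝ᵥ f k) := by
    rw [IsHermitian.mulVec_dotProduct_comm hH, hev, dotProduct_smul, smul_eq_mul]
  have hm : 0 < m := lt_of_le_of_lt (Nat.zero_le _) i.isLt
  set o : Fin m := ⟨0, hm⟩ with ho
  have hoi : o ≠ i := fun h => by
    have := congrArg Fin.val h
    simp [ho, hi] at this
  have hlast (k : Fin m) (hko : k ≠ o) (hki : k ≠ i) : lam k ≤ θ := by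
    have h0 : o ≤ k := Nat.zero_le _
    have h1 : i ≤ k := by
      rw [Fin.le_def, hi]
      exact Nat.one_le_iff_ne_zero.2 fun h => hko (Fin.ext h)
    exact eigenvalue_le_of_codim_two hf hev hθ hoi hko.symm hki.symm (hanti h0) (hanti h1)
  have huu : 0 < u ⬝ᵥ u := by
    have h1 : 0 ≤ u ⬝ᵥ u := Finset.sum_nonneg fun _ _ => mul_self_nonneg _
    exact lt_of_le_of_ne h1 fun h => hu0 (dotProduct_self_eq_zero.1 h.symm)
  have hlam0 : lam o = 1 := by
    refine le_antisymm ?_ ?_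
    · have h := hle (f o)
      rw [hev, dotProduct_smul, hf, if_pos rfl] at h
      simpa using h
    · by_contra hcon
      rw [hpar u u, Finset.sum_eq_zero] at huu
      · exact lt_irrefl _ huu
      · intro k _
        have h1 := hcoef u k
        rw [hu] at h1
        have h2 : lam k ≤ lam o := hanti (Nat.zero_le _)
        have h3 : u ⬝ᵥ f k = 0 := by
          have : (1 - lam k) * (u ⬝ᵥ f k) = 0 := by linarith
          rcases mul_eq_zero.1 this with h | h
          · linarith
          · exact h
        rw [h3, zero_mul]
  obtain ⟨t, ht⟩ := huniq (f o) (by rw [hev, hlam0, one_smul])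
  have htu : t ^ 2 * (u ⬝ᵥ u) = 1 := by
    have := hf o o
    rw [if_pos rfl, ht, smul_dotProduct, dotProduct_smul, smul_eq_mul, smul_eq_mul] at this
    linarith
  have hc0 : (v ⬝ᵥ f o) ^ 2 ≤ ρ := by
    rw [ht, dotProduct_smul, smul_eq_mul, mul_pow]
    have := mul_le_mul_of_nonneg_left hρ (sq_nonneg t)
    have h2 : t ^ 2 * (ρ * (u ⬝ᵥ u)) = ρ * (t ^ 2 * (u ⬝ᵥ u)) := by ring
    rw [h2, htu, mul_one] at this
    exact this
  have hlam1 : lam i < 1 := by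
    refine lt_of_le_of_ne (hlam0 ▸ hanti (Nat.zero_le _)) fun h => ?_
    obtain ⟨s, hs⟩ := huniq (f i) (by rw [hev, h, one_smul])
    have h1 := hf o i
    have h2 := hf i i
    rw [if_neg hoi, ht, hs, smul_dotProduct, dotProduct_smul, smul_eq_mul, smul_eq_mul] at h1
    rw [if_pos rfl, hs, smul_dotProduct, dotProduct_smul, smul_eq_mul, smul_eq_mul] at h2
    have ht0 : t ≠ 0 := by
      rintro rfl
      simp at htu
    rcases mul_eq_zero.1 h1 with h | h
    · exact ht0 h
    · rw [h, mul_zero] at h2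
      exact zero_ne_one h2
  have hsum : ∑ k, (lam k - μ) ^ 2 * (v ⬝ᵥ f k) ^ 2 ≤ η := by
    rw [hpar] at hη
    refine le_trans (le_of_eq (Finset.sum_congr rfl fun k _ => ?_)) hη
    rw [sub_dotProduct, hcoef, smul_dotProduct, smul_eq_mul]
    ring
  have hsmall (R : Finset (Fin m)) (hR : ∀ k ∈ R, lam k ≤ θ) :
      ∑ k ∈ R, (v ⬝ᵥ f k) ^ 2 ≤ 4 * η / μ ^ 2 := by
    rw [le_div_iff₀ (by positivity)]
    have h1 : ∑ k ∈ R, (v ⬝ᵥ f k) ^ 2 * μ ^ 2 ≤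
        ∑ k ∈ R, 4 * ((lam k - μ) ^ 2 * (v ⬝ᵥ f k) ^ 2) := by
      refine Finset.sum_le_sum fun k hk => ?_
      have h2 := hR k hk
      have h3 : μ ^ 2 ≤ 4 * (lam k - μ) ^ 2 := by nlinarith
      nlinarith [sq_nonneg (v ⬝ᵥ f k)]
    rw [← Finset.sum_mul, ← Finset.mul_sum] at h1
    have h4 : ∑ k ∈ R, (lam k - μ) ^ 2 * (v ⬝ᵥ f k) ^ 2 ≤
        ∑ k, (lam k - μ) ^ 2 * (v ⬝ᵥ f k) ^ 2 :=
      Finset.sum_le_sum_of_subset_of_nonneg (Finset.subset_univ _) fun _ _ _ => by positivity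
    linarith
  have hvv : v ⬝ᵥ v = (v ⬝ᵥ f o) ^ 2 + ∑ k ∈ Finset.univ.erase o, (v ⬝ᵥ f k) ^ 2 := by
    rw [hpar v v, ← Finset.add_sum_erase _ _ (Finset.mem_univ o)]
    simp only [pow_two]
  have hi_mem : i ∈ Finset.univ.erase o := by simp [hoi.symm]
  have hlam_gt : θ < lam i := by
    by_contra hcon
    have h1 := hsmall (Finset.univ.erase o) fun k hk => by
      by_cases hki : k = i
      · rw [hki]
        exact not_lt.1 hcon
      · exact hlast k (Finset.ne_of_mem_erase hk) hki
    linarith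
  have hzero (k : Fin m) (hk : k ≠ i) : w ⬝ᵥ f k = 0 := by
    have h1 := hcoef w k
    rw [hw, smul_dotProduct, smul_eq_mul] at h1
    have h2 : (lam i - lam k) * (w ⬝ᵥ f k) = 0 := by linarith
    rcases mul_eq_zero.1 h2 with h | h
    · exfalso
      by_cases hko : k = o
      · rw [hko, hlam0] at h
        linarith
      · have := hlast k hko hk
        linarith
    · exact h
  have hw2 : (w ⬝ᵥ f i) ^ 2 = 1 := by
    rw [← hw1, hpar w w, Finset.sum_eq_single i (fun k _ hk => by rw [hzero k hk, zero_mul])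
      (by simp), pow_two]
  have hvw : (v ⬝ᵥ w) ^ 2 = (v ⬝ᵥ f i) ^ 2 := by
    rw [hpar v w, Finset.sum_eq_single i (fun k _ hk => by rw [hzero k hk, mul_zero])
      (by simp), mul_pow, hw2, mul_one]
  have h1 := hsmall ((Finset.univ.erase o).erase i) fun k hk =>
    hlast k (Finset.ne_of_mem_erase (Finset.mem_of_mem_erase hk)) (Finset.ne_of_mem_erase hk)
  rw [← Finset.add_sum_erase _ _ hi_mem] at hvv
  linarith

lemma sq_dotProduct_mulVec_le {m : ℕ} {M : Matrix (Fin m) (Fin m) ℝ} {X : ℝ}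
    (hM : specNorm M ≤ X) (y x : Fin m → ℝ) :
    (y ⬝ᵥ (M *ᵥ x)) ^ 2 ≤ X ^ 2 * ((y ⬝ᵥ y) * (x ⬝ᵥ x)) := by
  have h0 : 0 ≤ specNorm M := norm_nonneg _
  have h1 := Finset.sum_mul_sq_le_sq_mul_sq Finset.univ y (M *ᵥ x)
  have h2 := sum_mulVec_sq_le M x
  have hs (z : Fin m → ℝ) : z ⬝ᵥ z = ∑ i, z i ^ 2 := by simp only [dotProduct, pow_two]
  have hy : 0 ≤ ∑ i, y i ^ 2 := Finset.sum_nonneg fun _ _ => sq_nonneg _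
  have hx : 0 ≤ ∑ i, x i ^ 2 := Finset.sum_nonneg fun _ _ => sq_nonneg _
  rw [hs, hs]
  calc _ ≤ (∑ i, y i ^ 2) * ∑ i, (M *ᵥ x) i ^ 2 := h1
    _ ≤ (∑ i, y i ^ 2) * (X ^ 2 * ∑ i, x i ^ 2) := by
        refine mul_le_mul_of_nonneg_left (h2.trans ?_) hy
        gcongr
    _ = _ := by ring

lemma dotProduct_mulVec_self_le {m : ℕ} {M : Matrix (Fin m) (Fin m) ℝ} {X : ℝ}
    (hM : specNorm M ≤ X) (x : Fin m → ℝ) : x ⬝ᵥ (M *ᵥ x) ≤ X * (x ⬝ᵥ x) := by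
  have h0 : 0 ≤ specNorm M := norm_nonneg _
  have hx : 0 ≤ x ⬝ᵥ x := Finset.sum_nonneg fun _ _ => mul_self_nonneg _
  refine (le_abs_self _).trans (abs_le_of_sq_le_sq ?_ (mul_nonneg (h0.trans hM) hx))
  refine (sq_dotProduct_mulVec_le hM x x).trans (le_of_eq (by ring))

lemma indicator_dotProduct_mulVec {m : ℕ} (M : Matrix (Fin m) (Fin m) ℝ)
    (U W : Finset (Fin m)) :
    (fun i => if i ∈ U then (1 : ℝ) else 0) ⬝ᵥ (M *ᵥ fun i => if i ∈ W then (1 : ℝ) else 0) =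
      ∑ i ∈ U, ∑ j ∈ W, M i j := by
  simp [dotProduct, Matrix.mulVec, Finset.sum_ite_mem]

lemma indicator_dotProduct_self {m : ℕ} (U : Finset (Fin m)) :
    (fun i => if i ∈ U then (1 : ℝ) else 0) ⬝ᵥ (fun i => if i ∈ U then (1 : ℝ) else 0) =
      U.card := by
  simp [dotProduct]

/-- A nonempty union of components inside a block with large minimum degree and small spectral
discrepancy covers more than half of the block. -/
lemma card_lt_two_mul_card {m n : ℕ} {A B : Matrix (Fin m) (Fin m) ℝ} {X a : ℝ} (hn : 0 < n)
    (hE : specNorm (A - B) ≤ X) (ha : 0 < a) (hXa : 50 * X ≤ a) {I : Finset (Fin m)}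
    (hI : I.card = n) (hB : ∀ i ∈ I, ∀ j ∈ I, B i j = a / n)
    (hdeg : ∀ i ∈ I, 0.1 * a ≤ ∑ j ∈ I, A i j) {U : Finset (Fin m)} (hU : U ⊆ I)
    (hne : U.Nonempty) (hcut : ∀ i ∈ U, ∀ j ∈ I \ U, A i j = 0) : n < 2 * U.card := by
  by_contra hcon
  have hX0 : 0 ≤ X := (norm_nonneg _ : 0 ≤ specNorm (A - B)).trans hE
  have hn' : (0 : ℝ) < n := by exact_mod_cast hn
  set x : ℝ := (U.card : ℝ) with hx
  have hx0 : 0 < x := Nat.cast_pos.2 hne.card_pos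
  have hxn : 2 * x ≤ n := by
    rw [hx]
    exact_mod_cast not_lt.1 hcon
  have hW : ((I \ U).card : ℝ) = n - x := by
    rw [Finset.cast_card_sdiff hU, hI]
  have e1 := sq_dotProduct_mulVec_le hE (fun i => if i ∈ U then (1 : ℝ) else 0)
    (fun i => if i ∈ I \ U then (1 : ℝ) else 0)
  rw [indicator_dotProduct_mulVec, indicator_dotProduct_self, indicator_dotProduct_self, hW] at e1
  have s1 : ∑ i ∈ U, ∑ j ∈ I \ U, (A - B) i j = -(x * ((n - x) * (a / n))) := by
    rw [Finset.sum_congr rfl fun i hi => Finset.sum_congr rfl fun j hj =>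
      (by rw [Matrix.sub_apply, hcut i hi j hj, hB i (hU hi) j (Finset.mem_sdiff.1 hj).1, zero_sub] :
        (A - B) i j = -(a / n))]
    simp only [Finset.sum_const, nsmul_eq_mul, hW]
    ring
  have e2 := dotProduct_mulVec_self_le hE (fun i => if i ∈ U then (1 : ℝ) else 0)
  rw [indicator_dotProduct_mulVec, indicator_dotProduct_self] at e2
  have s2 : ∑ i ∈ U, ∑ j ∈ U, (A - B) i j = (∑ i ∈ U, ∑ j ∈ U, A i j) - x * (x * (a / n)) := by
    simp only [Matrix.sub_apply, Finset.sum_sub_distrib]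
    congr 1
    rw [Finset.sum_congr rfl fun i hi => Finset.sum_congr rfl fun j hj => hB i (hU hi) j (hU hj)]
    simp only [Finset.sum_const, nsmul_eq_mul, hx]
  have s3 : x * (0.1 * a) ≤ ∑ i ∈ U, ∑ j ∈ U, A i j := by
    have : ∀ i ∈ U, 0.1 * a ≤ ∑ j ∈ U, A i j := by
      intro i hi
      have h1 := hdeg i (hU hi)
      rwa [← Finset.sum_sdiff hU, Finset.sum_eq_zero (hcut i hi), zero_add] at h1
    have h2 := Finset.sum_le_sum this
    rwa [Finset.sum_const, nsmul_eq_mul] at h2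
  rw [s1] at e1
  rw [s2] at e2
  set α := a / n with hα
  have hα0 : 0 < α := by positivity
  have haα : a = α * n := by
    rw [hα]
    field_simp
  have hc : 0 < x * (n - x) := mul_pos hx0 (by linarith)
  have k1 : α ^ 2 * (x * (n - x)) ≤ X ^ 2 := by
    have : α ^ 2 * (x * (n - x)) * (x * (n - x)) ≤ X ^ 2 * (x * (n - x)) := by nlinarith
    exact le_of_mul_le_mul_right this hc
  have k2 : 0.1 * a ≤ x * α + X := by
    have : (0.1 * a) * x ≤ (x * α + X) * x := by nlinarith
    exact le_of_mul_le_mul_right this hx0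
  have k3 : (α * x) * a ≤ 2 * X ^ 2 := by
    rw [haα]
    nlinarith [mul_pos hα0 hα0]
  have k4 : X ^ 2 ≤ a / 50 * (a / 50) := by nlinarith
  have k5 : 0.08 * a ≤ α * x := by linarith
  nlinarith [mul_le_mul_of_nonneg_right k5 ha.le]

lemma adjOf_comm {m : ℕ} (ω : Fin m → Fin m → Bool) (i j : Fin m) :
    adjOf ω i j = adjOf ω j i := by
  rw [adjOf_eq_sortedPair, adjOf_eq_sortedPair, sortedPair_eq_iff.2 (Or.inr ⟨rfl, rfl⟩)]

lemma adjOf_nonneg {m : ℕ} (ω : Fin m → Fin m → Bool) (i j : Fin m) : 0 ≤ adjOf ω i j := by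
  rw [adjOf_eq_sortedPair]
  split_ifs <;> norm_num

/-- A function that is constant along edges of a typical graph is constant. -/
lemma IsTypical.eq_of_forall_adj_eq {n : ℕ} {a b K : ℝ} {ω : Fin (2 * n) → Fin (2 * n) → Bool}
    (h : IsTypical n a b K ω) (ha : 0 < a) (hKa : 50 * (K * Real.sqrt (a + b)) ≤ a)
    {y : Fin (2 * n) → ℝ} (hy : ∀ i j, adjOf ω i j ≠ 0 → y i = y j) (i j : Fin (2 * n)) :
    y i = y j := by
  have hn : 0 < n := by
    have := i.isLt
    omega
  have key (i j : Fin (2 * n)) (hij : i.val < n ↔ j.val < n) : y i = y j := by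
    by_contra hne
    set I := Finset.univ.filter fun j : Fin (2 * n) => (i.val < n ↔ j.val < n) with hI
    have hmem (k l : Fin (2 * n)) (hk : k ∈ I) : l ∈ I ↔ (k.val < n ↔ l.val < n) := by
      simp only [hI, Finset.mem_filter, Finset.mem_univ, true_and] at hk ⊢
      rw [hk]
    have hB : ∀ k ∈ I, ∀ l ∈ I, Bmat n a b k l = a / n := fun k hk l hl =>
      if_pos ((hmem k l hk).1 hl)
    have hdeg : ∀ k ∈ I, 0.1 * a ≤ ∑ l ∈ I, adjOf ω k l := by
      intro k hk
      have h1 := h.2.1 k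
      rwa [Finset.filter_congr fun l _ => (hmem k l hk).symm, Finset.filter_mem_eq_inter,
        Finset.univ_inter] at h1
    have hiI : i ∈ I := by simp [hI]
    have hjI : j ∈ I := by simpa [hI] using hij
    set U := I.filter fun k => y k = y i with hU
    have hUI : U ⊆ I := Finset.filter_subset _ _
    have hcut : ∀ k ∈ U, ∀ l ∈ I \ U, adjOf ω k l = 0 := by
      intro k hk l hl
      by_contra hcon
      have h1 := hy k l hcon
      rw [Finset.mem_sdiff] at hl
      refine hl.2 (Finset.mem_filter.2 ⟨hl.1, ?_⟩)
      rw [← h1]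
      exact (Finset.mem_filter.1 hk).2
    have c1 := card_lt_two_mul_card hn h.1 ha hKa (card_val_lt_iff i) hB hdeg hUI
      ⟨i, Finset.mem_filter.2 ⟨hiI, rfl⟩⟩ hcut
    have c2 := card_lt_two_mul_card hn h.1 ha hKa (card_val_lt_iff i) hB hdeg
      (Finset.sdiff_subset (s := I) (t := U))
      ⟨j, Finset.mem_sdiff.2 ⟨hjI, fun hj => hne (Finset.mem_filter.1 hj).2.symm⟩⟩
      (fun k hk l hl => by
        rw [Finset.sdiff_sdiff_eq_self hUI] at hl
        rw [adjOf_comm]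
        exact hcut l hl k hk)
    have c3 := Finset.card_sdiff_add_card_eq_card hUI
    have c4 : I.card = n := card_val_lt_iff i
    omega
  obtain ⟨k, l, hk, hl, hkl⟩ := h.2.2
  have hkl' : y k = y l := hy k l (by rw [hkl]; exact one_ne_zero)
  have hall (i : Fin (2 * n)) : y i = y k := by
    by_cases hi : i.val < n
    · exact key i k (by simp [hi, hk])
    · exact (key i l (by simp [hi, hl])).trans hkl'.symm
  rw [hall i, hall j]

lemma normAdj_mulVec_apply {m : ℕ} (ω : Fin m → Fin m → Bool) (x : Fin m → ℝ) (i : Fin m) :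
    (normAdj ω *ᵥ x) i =
      (Real.sqrt (deg ω i))⁻¹ * (adjOf ω *ᵥ fun j => x j / Real.sqrt (deg ω j)) i := by
  have h : (Matrix.diagonal fun i => (Real.sqrt (deg ω i))⁻¹) *ᵥ x =
      fun j => x j / Real.sqrt (deg ω j) := by
    funext j
    rw [mulVec_diagonal, div_eq_inv_mul]
  rw [normAdj, ← mulVec_mulVec, ← mulVec_mulVec, h, mulVec_diagonal]

lemma dotProduct_normAdj_mulVec {m : ℕ} (ω : Fin m → Fin m → Bool) (x : Fin m → ℝ) :
    x ⬝ᵥ (normAdj ω *ᵥ x) = (fun j => x j / Real.sqrt (deg ω j)) ⬝ᵥ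
      (adjOf ω *ᵥ fun j => x j / Real.sqrt (deg ω j)) := by
  simp only [dotProduct, normAdj_mulVec_apply]
  exact Finset.sum_congr rfl fun i _ => by rw [div_eq_mul_inv, mul_assoc]

lemma dotProduct_self_eq_sum_deg_mul {m : ℕ} {ω : Fin m → Fin m → Bool}
    (hpos : ∀ i, 0 < deg ω i) (x : Fin m → ℝ) :
    x ⬝ᵥ x = ∑ i, deg ω i * (x i / Real.sqrt (deg ω i)) ^ 2 := by
  refine Finset.sum_congr rfl fun i _ => ?_
  have h := hpos i
  rw [div_pow, Real.sq_sqrt h.le]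
  field_simp

lemma sum_adj_mul_sub_sq {m : ℕ} (ω : Fin m → Fin m → Bool) (y : Fin m → ℝ) :
    ∑ i, ∑ j, adjOf ω i j * (y i - y j) ^ 2 =
      2 * (∑ i, deg ω i * y i ^ 2) - 2 * (y ⬝ᵥ (adjOf ω *ᵥ y)) := by
  have e1 : ∑ i, ∑ j, adjOf ω i j * y i ^ 2 = ∑ i, deg ω i * y i ^ 2 := by
    simp only [deg, Finset.sum_mul]
  have e2 : ∑ i, ∑ j, adjOf ω i j * y j ^ 2 = ∑ i, deg ω i * y i ^ 2 := by
    rw [Finset.sum_comm, ← e1]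
    exact Finset.sum_congr rfl fun i _ => Finset.sum_congr rfl fun j _ => by rw [adjOf_comm]
  have e3 : ∑ i, ∑ j, adjOf ω i j * (y i * y j) = y ⬝ᵥ (adjOf ω *ᵥ y) := by
    simp only [dotProduct, Matrix.mulVec, Finset.mul_sum]
    exact Finset.sum_congr rfl fun i _ => Finset.sum_congr rfl fun j _ => by ring
  calc _ = ∑ i, ∑ j, (adjOf ω i j * y i ^ 2 + adjOf ω i j * y j ^ 2 -
        2 * (adjOf ω i j * (y i * y j))) :=
        Finset.sum_congr rfl fun i _ => Finset.sum_congr rfl fun j _ => by ring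
    _ = _ := by
        simp only [Finset.sum_sub_distrib, Finset.sum_add_distrib, ← Finset.mul_sum, e1, e2, e3]
        ring

lemma chi_sq (n : ℕ) (i : Fin (2 * n)) : chi n i ^ 2 = 1 := by
  unfold chi
  split_ifs <;> norm_num

lemma sum_chi (n : ℕ) : ∑ i, chi n i = 0 := by
  simp only [chi]
  rw [Finset.sum_ite, Finset.sum_const, Finset.sum_const, card_val_lt, card_val_not_lt]
  simp

lemma chi_dotProduct_self (n : ℕ) : chi n ⬝ᵥ chi n = 2 * n := by
  simp only [dotProduct, ← pow_two, chi_sq]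
  simp

lemma Bmat_mulVec_apply {n : ℕ} (a b : ℝ) (z : Fin (2 * n) → ℝ) (i : Fin (2 * n)) :
    (Bmat n a b *ᵥ z) i = (a + b) / (2 * n) * (∑ j, z j) +
      (a - b) / (2 * n) * (chi n i * (chi n ⬝ᵥ z)) := by
  simp only [Matrix.mulVec, dotProduct, Finset.mul_sum, ← Finset.sum_add_distrib]
  refine Finset.sum_congr rfl fun j _ => ?_
  have hn : (n : ℝ) ≠ 0 := by
    have := i.isLt
    exact Nat.cast_ne_zero.2 (by omega)
  simp only [Bmat, Matrix.of_apply, chi]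
  by_cases hi : i.val < n <;> by_cases hj : j.val < n <;> simp only [hi, hj, if_true, if_false,
    iff_true, iff_false, not_true] <;> field_simp <;> ring

lemma Bmat_mulVec_chi {n : ℕ} (a b : ℝ) (i : Fin (2 * n)) :
    (Bmat n a b *ᵥ chi n) i = (a - b) * chi n i := by
  have hn : (n : ℝ) ≠ 0 := by
    have := i.isLt
    exact Nat.cast_ne_zero.2 (by omega)
  rw [Bmat_mulVec_apply, sum_chi, chi_dotProduct_self]
  field_simp
  ring

lemma Bmat_mulVec_one {n : ℕ} (a b : ℝ) (i : Fin (2 * n)) :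
    (Bmat n a b *ᵥ fun _ => 1) i = a + b := by
  have hn : (n : ℝ) ≠ 0 := by
    have := i.isLt
    exact Nat.cast_ne_zero.2 (by omega)
  have h : chi n ⬝ᵥ (fun _ => 1) = 0 := by simpa [dotProduct] using sum_chi n
  rw [Bmat_mulVec_apply, h]
  simp
  field_simp

lemma adjOf_mulVec_apply {n : ℕ} (a b : ℝ) (ω : Fin (2 * n) → Fin (2 * n) → Bool)
    (z : Fin (2 * n) → ℝ) (i : Fin (2 * n)) :
    (adjOf ω *ᵥ z) i = (Bmat n a b *ᵥ z) i + ((adjOf ω - Bmat n a b) *ᵥ z) i := by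
  rw [sub_mulVec]
  simp

lemma deg_eq_add {n : ℕ} (a b : ℝ) (ω : Fin (2 * n) → Fin (2 * n) → Bool) (i : Fin (2 * n)) :
    deg ω i = (a + b) + ((adjOf ω - Bmat n a b) *ᵥ fun _ => 1) i := by
  rw [← Bmat_mulVec_one a b i, ← adjOf_mulVec_apply]
  simp [deg, Matrix.mulVec, dotProduct]

lemma IsTypical.le_deg {n : ℕ} {a b K : ℝ} {ω : Fin (2 * n) → Fin (2 * n) → Bool}
    (h : IsTypical n a b K ω) (i : Fin (2 * n)) : 0.1 * a ≤ deg ω i :=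
  (h.2.1 i).trans (Finset.sum_le_sum_of_subset_of_nonneg (Finset.subset_univ _)
    fun _ _ _ => adjOf_nonneg _ _ _)

lemma abs_sum_deg_sub_le {n : ℕ} {a b X : ℝ} {ω : Fin (2 * n) → Fin (2 * n) → Bool}
    (hE : specNorm (adjOf ω - Bmat n a b) ≤ X) :
    |∑ i, deg ω i - 2 * n * (a + b)| ≤ 2 * n * X := by
  have hX0 : 0 ≤ X := (norm_nonneg _ : 0 ≤ specNorm (adjOf ω - Bmat n a b)).trans hE
  have h1 := sq_dotProduct_mulVec_le hE (fun _ => 1) (fun _ => 1)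
  have h2 : (fun _ => (1 : ℝ)) ⬝ᵥ ((adjOf ω - Bmat n a b) *ᵥ fun _ => 1) =
      ∑ i, deg ω i - 2 * n * (a + b) := by
    simp only [deg_eq_add a b ω, Finset.sum_add_distrib, dotProduct]
    simp
    ring
  have h3 : (fun _ : Fin (2 * n) => (1 : ℝ)) ⬝ᵥ (fun _ => 1) = 2 * n := by simp [dotProduct]
  rw [h2, h3] at h1
  exact abs_le_of_sq_le_sq (h1.trans (le_of_eq (by ring))) (by positivity)

lemma sq_sum_deg_mul_chi_le {n : ℕ} {a b X : ℝ} {ω : Fin (2 * n) → Fin (2 * n) → Bool}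
    (hE : specNorm (adjOf ω - Bmat n a b) ≤ X) :
    (∑ i, deg ω i * chi n i) ^ 2 ≤ (2 * n * X) ^ 2 := by
  have h1 := sq_dotProduct_mulVec_le hE (chi n) (fun _ => 1)
  have h2 : chi n ⬝ᵥ ((adjOf ω - Bmat n a b) *ᵥ fun _ => 1) = ∑ i, deg ω i * chi n i := by
    have h3 (i : Fin (2 * n)) : deg ω i * chi n i =
        (a + b) * chi n i + chi n i * ((adjOf ω - Bmat n a b) *ᵥ fun _ => 1) i := by
      rw [deg_eq_add a b ω]
      ring
    simp only [h3, Finset.sum_add_distrib]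
    rw [← Finset.mul_sum, sum_chi, mul_zero, zero_add]
    rfl
  have h3 : (fun _ : Fin (2 * n) => (1 : ℝ)) ⬝ᵥ (fun _ => 1) = 2 * n := by simp [dotProduct]
  rw [h2, h3, chi_dotProduct_self] at h1
  exact h1.trans (le_of_eq (by ring))

lemma sum_sq_normAdj_residual_le {n : ℕ} {a b X δ : ℝ} {ω : Fin (2 * n) → Fin (2 * n) → Bool}
    (hE : specNorm (adjOf ω - Bmat n a b) ≤ X) (hδ : 0 < δ) (hdeg : ∀ i, δ ≤ deg ω i)
    (hab : 0 ≤ a - b) (hd : 0 < a + b) (hb : 0 ≤ b) :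
    (normAdj ω *ᵥ (fun i => Real.sqrt (deg ω i) * chi n i) -
      ((a - b) / (a + b)) • fun i => Real.sqrt (deg ω i) * chi n i) ⬝ᵥ
    (normAdj ω *ᵥ (fun i => Real.sqrt (deg ω i) * chi n i) -
      ((a - b) / (a + b)) • fun i => Real.sqrt (deg ω i) * chi n i) ≤ 8 * n * X ^ 2 / δ := by
  have hX0 : 0 ≤ X := (norm_nonneg _ : 0 ≤ specNorm (adjOf ω - Bmat n a b)).trans hE
  have hXE : specNorm (adjOf ω - Bmat n a b) ^ 2 ≤ X ^ 2 :=
    pow_le_pow_left₀ (norm_nonneg _) hE 2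
  set E := adjOf ω - Bmat n a b with hEdef
  have hent (i : Fin (2 * n)) : (normAdj ω *ᵥ (fun i => Real.sqrt (deg ω i) * chi n i) -
      ((a - b) / (a + b)) • fun i => Real.sqrt (deg ω i) * chi n i) i =
      (Real.sqrt (deg ω i))⁻¹ *
        ((E *ᵥ chi n) i - (a - b) / (a + b) * ((E *ᵥ fun _ => 1) i * chi n i)) := by
    have hr (j : Fin (2 * n)) : 0 < Real.sqrt (deg ω j) :=
      Real.sqrt_pos.2 (hδ.trans_le (hdeg j))
    have h1 : (fun j => Real.sqrt (deg ω j) * chi n j / Real.sqrt (deg ω j)) = chi n := by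
      funext j
      have := (hr j).ne'
      field_simp
    rw [Pi.sub_apply, normAdj_mulVec_apply, h1, adjOf_mulVec_apply a b, Bmat_mulVec_chi,
      Pi.smul_apply, smul_eq_mul]
    have h2 : Real.sqrt (deg ω i) = (Real.sqrt (deg ω i))⁻¹ * deg ω i := by
      have h3 := Real.mul_self_sqrt (hδ.trans_le (hdeg i)).le
      have := (hr i).ne'
      field_simp
      linarith
    have h4 : (a - b) / (a + b) * (Real.sqrt (deg ω i) * chi n i) =
        (Real.sqrt (deg ω i))⁻¹ * ((a - b) / (a + b) * (deg ω i * chi n i)) := by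
      conv_lhs => rw [h2]
      ring
    rw [h4, ← mul_sub]
    congr 1
    rw [deg_eq_add a b ω i]
    field_simp
    ring
  have hratio : ((a - b) / (a + b)) ^ 2 ≤ 1 := by
    have h1 : (a - b) / (a + b) ≤ 1 := (div_le_one hd).2 (by linarith)
    exact pow_le_one₀ (by positivity) h1
  have hbound (i : Fin (2 * n)) : ((Real.sqrt (deg ω i))⁻¹ *
        ((E *ᵥ chi n) i - (a - b) / (a + b) * ((E *ᵥ fun _ => 1) i * chi n i))) ^ 2 ≤
      2 / δ * ((E *ᵥ chi n) i ^ 2 + (E *ᵥ fun _ => 1) i ^ 2) := by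
    rw [mul_pow, inv_pow, Real.sq_sqrt (hδ.trans_le (hdeg i)).le]
    have h1 : (deg ω i)⁻¹ ≤ δ⁻¹ := inv_anti₀ hδ (hdeg i)
    have h2 : ((E *ᵥ chi n) i - (a - b) / (a + b) * ((E *ᵥ fun _ => 1) i * chi n i)) ^ 2 ≤
        2 * ((E *ᵥ chi n) i ^ 2 + (E *ᵥ fun _ => 1) i ^ 2) := by
      have h3 : ((a - b) / (a + b) * ((E *ᵥ fun _ => 1) i * chi n i)) ^ 2 ≤
          (E *ᵥ fun _ => 1) i ^ 2 := by
        rw [mul_pow, mul_pow, chi_sq, mul_one]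
        exact mul_le_of_le_one_left (sq_nonneg _) hratio
      nlinarith [sq_nonneg ((E *ᵥ chi n) i + (a - b) / (a + b) * ((E *ᵥ fun _ => 1) i * chi n i))]
    calc _ ≤ δ⁻¹ * (2 * ((E *ᵥ chi n) i ^ 2 + (E *ᵥ fun _ => 1) i ^ 2)) := by gcongr
      _ = _ := by ring
  have g1 := sum_mulVec_sq_le E (chi n)
  have g2 := sum_mulVec_sq_le E (fun _ => 1)
  have c1 : ∑ i, chi n i ^ 2 = 2 * n := by simp [chi_sq]
  have c2 : ∑ _i : Fin (2 * n), (1 : ℝ) ^ 2 = 2 * n := by simp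
  rw [c1] at g1
  rw [c2] at g2
  simp only [dotProduct, hent]
  calc _ ≤ ∑ i, 2 / δ * ((E *ᵥ chi n) i ^ 2 + (E *ᵥ fun _ => 1) i ^ 2) :=
        Finset.sum_le_sum fun i _ => by
          rw [← pow_two]
          exact hbound i
    _ = 2 / δ * (∑ i, (E *ᵥ chi n) i ^ 2 + ∑ i, (E *ᵥ fun _ => 1) i ^ 2) := by
        rw [← Finset.mul_sum, Finset.sum_add_distrib]
    _ ≤ 2 / δ * (X ^ 2 * (2 * n) + X ^ 2 * (2 * n)) := by
        have e1 := g1.trans (mul_le_mul_of_nonneg_right hXE (by positivity))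
        have e2 := g2.trans (mul_le_mul_of_nonneg_right hXE (by positivity))
        gcongr
    _ = _ := by ring

lemma parameter_bounds {K d s : ℝ} (hK : 1 ≤ K) (hd : 0 < d)
    (hs : 10 ^ 9 * K ^ 2 * Real.sqrt d ≤ s) :
    0 < s ∧ 10 ^ 9 * (K * Real.sqrt d) ≤ s ∧ 644 * K ^ 2 * d ^ 2 / s ^ 2 ≤ d / 10 ^ 5 := by
  have hr : 0 < Real.sqrt d := Real.sqrt_pos.2 hd
  have hr2 : Real.sqrt d ^ 2 = d := Real.sq_sqrt hd.le
  have hKK : K ≤ K ^ 2 := by nlinarith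
  have h1 : 10 ^ 9 * (K * Real.sqrt d) ≤ s := by nlinarith
  have h0 : 0 < s := lt_of_lt_of_le (by positivity) h1
  refine ⟨h0, h1, ?_⟩
  have h2 : (10 ^ 9 * (K * Real.sqrt d)) ^ 2 ≤ s ^ 2 := pow_le_pow_left₀ (by positivity) h1 2
  have h3 : (10 ^ 9 * (K * Real.sqrt d)) ^ 2 = 10 ^ 18 * K ^ 2 * d := by
    rw [mul_pow, mul_pow, hr2]
    ring
  rw [h3] at h2
  rw [div_le_div_iff₀ (by positivity) (by norm_num)]
  have h4 : 0 < K ^ 2 * d ^ 2 := by positivity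
  nlinarith [mul_le_mul_of_nonneg_right h2 hd.le]

lemma IsTypical.sq_norm_sub_sq_inner_le {n : ℕ} {a b K : ℝ}
    {ω : Fin (2 * n) → Fin (2 * n) → Bool} (h : IsTypical n a b K ω) (hK : 1 ≤ K) (hb : 1 ≤ b)
    (hs : 10 ^ 9 * K ^ 2 * Real.sqrt (a + b) ≤ a - b) (hd : 0 < a + b)
    (hH : (normAdj ω).IsHermitian) {lam : Fin (2 * n) → ℝ} {σ : Equiv.Perm (Fin (2 * n))}
    (hlam : lam = hH.eigenvalues ∘ σ) (hanti : Antitone lam) {i : Fin (2 * n)} (hi : i.val = 1)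
    {w : Fin (2 * n) → ℝ} (hw : normAdj ω *ᵥ w = lam i • w) (hw1 : w ⬝ᵥ w = 1) :
    ∑ j, deg ω j - ((fun j => Real.sqrt (deg ω j) * chi n j) ⬝ᵥ w) ^ 2 ≤
      n * (644 * K ^ 2 * (a + b) ^ 2 / (a - b) ^ 2) := by
  obtain ⟨hs0, hXs, hq⟩ := parameter_bounds hK hd hs
  have hn : 0 < n := by
    have := i.isLt
    omega
  have hn' : (0 : ℝ) < n := by exact_mod_cast hn
  have hX2 : (K * Real.sqrt (a + b)) ^ 2 = K ^ 2 * (a + b) := by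
    rw [mul_pow, Real.sq_sqrt hd.le]
  have hX0 : 0 ≤ K * Real.sqrt (a + b) := by positivity
  have hE := h.1
  have hconst {y : Fin (2 * n) → ℝ} := h.eq_of_forall_adj_eq (y := y) (by linarith) (by linarith)
  set X := K * Real.sqrt (a + b) with hX
  set d := a + b with hddef
  set s := a - b with hsdef
  have hsd : s ≤ d := by linarith
  have hδ : 0 < d / 20 := by positivity
  have hdeg (j : Fin (2 * n)) : d / 20 ≤ deg ω j := le_trans (by linarith) (h.le_deg j)
  have hpos (j : Fin (2 * n)) : 0 < deg ω j := hδ.trans_le (hdeg j)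
  have hr (j : Fin (2 * n)) : 0 < Real.sqrt (deg ω j) := Real.sqrt_pos.2 (hpos j)
  have hrr (j : Fin (2 * n)) : Real.sqrt (deg ω j) * Real.sqrt (deg ω j) = deg ω j :=
    Real.mul_self_sqrt (hpos j).le
  have hvol := abs_le.1 (abs_sum_deg_sub_le hE)
  have hvol' : n * d ≤ ∑ j, deg ω j := by nlinarith
  have hform (x : Fin (2 * n) → ℝ) : ∑ k, ∑ l, adjOf ω k l *
      (x k / Real.sqrt (deg ω k) - x l / Real.sqrt (deg ω l)) ^ 2 =
      2 * (x ⬝ᵥ x) - 2 * (x ⬝ᵥ (normAdj ω *ᵥ x)) := by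
    rw [dotProduct_normAdj_mulVec, dotProduct_self_eq_sum_deg_mul hpos,
      ← sum_adj_mul_sub_sq ω fun k => x k / Real.sqrt (deg ω k)]
  set u : Fin (2 * n) → ℝ := fun j => Real.sqrt (deg ω j) with hudef
  set v : Fin (2 * n) → ℝ := fun j => Real.sqrt (deg ω j) * chi n j with hvdef
  have huu : u ⬝ᵥ u = ∑ j, deg ω j := Finset.sum_congr rfl fun j _ => hrr j
  have hvv : v ⬝ᵥ v = ∑ j, deg ω j := Finset.sum_congr rfl fun j _ => by
    have h1 := chi_sq n j
    have h2 := hrr j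
    simp only [hvdef]
    calc _ = (Real.sqrt (deg ω j) * Real.sqrt (deg ω j)) * chi n j ^ 2 := by ring
      _ = _ := by rw [h1, h2, mul_one]
  have hvu : v ⬝ᵥ u = ∑ j, deg ω j * chi n j := Finset.sum_congr rfl fun j _ => by
    simp only [hvdef, hudef]
    calc _ = (Real.sqrt (deg ω j) * Real.sqrt (deg ω j)) * chi n j := by ring
      _ = _ := by rw [hrr j]
  have hle (x : Fin (2 * n) → ℝ) : x ⬝ᵥ (normAdj ω *ᵥ x) ≤ x ⬝ᵥ x := by
    have h1 : 0 ≤ ∑ k, ∑ l, adjOf ω k l *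
        (x k / Real.sqrt (deg ω k) - x l / Real.sqrt (deg ω l)) ^ 2 :=
      Finset.sum_nonneg fun k _ => Finset.sum_nonneg fun l _ =>
        mul_nonneg (adjOf_nonneg _ _ _) (sq_nonneg _)
    rw [hform] at h1
    linarith
  have hu : normAdj ω *ᵥ u = u := by
    funext j
    have h1 : (fun j => u j / Real.sqrt (deg ω j)) = fun _ => 1 := by
      funext j
      exact div_self (hr j).ne'
    have h2 : (adjOf ω *ᵥ fun _ => 1) j = deg ω j := by simp [deg, Matrix.mulVec, dotProduct]
    rw [normAdj_mulVec_apply, h1, h2, inv_mul_eq_div, div_eq_iff (hr j).ne']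
    exact (hrr j).symm
  have hu0 : u ≠ 0 := fun h0 => (hr i).ne' (congrFun h0 i)
  have huniq (x : Fin (2 * n) → ℝ) (hx : normAdj ω *ᵥ x = x) : ∃ t : ℝ, x = t • u := by
    refine ⟨x i / Real.sqrt (deg ω i), funext fun j => ?_⟩
    have h1 := hform x
    rw [hx, sub_self] at h1
    have h2 : ∀ k l, adjOf ω k l ≠ 0 →
        x k / Real.sqrt (deg ω k) = x l / Real.sqrt (deg ω l) := by
      intro k l hkl
      have hnn (k l : Fin (2 * n)) : 0 ≤ adjOf ω k l *
          (x k / Real.sqrt (deg ω k) - x l / Real.sqrt (deg ω l)) ^ 2 :=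
        mul_nonneg (adjOf_nonneg _ _ _) (sq_nonneg _)
      rw [Finset.sum_eq_zero_iff_of_nonneg
        fun k _ => Finset.sum_nonneg fun l _ => hnn k l] at h1
      have h3 := h1 k (Finset.mem_univ k)
      rw [Finset.sum_eq_zero_iff_of_nonneg fun l _ => hnn k l] at h3
      have h4 := h3 l (Finset.mem_univ l)
      exact sub_eq_zero.1 (pow_eq_zero_iff two_ne_zero |>.1 ((mul_eq_zero.1 h4).resolve_left hkl))
    have h5 := hconst h2 i j
    rw [Pi.smul_apply, smul_eq_mul, h5, hudef]
    exact (div_mul_cancel₀ _ (hr j).ne').symm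
  have hθ (x : Fin (2 * n) → ℝ) (hp : x ⬝ᵥ (fun j => (Real.sqrt (deg ω j))⁻¹) = 0)
      (hq : x ⬝ᵥ (fun j => (Real.sqrt (deg ω j))⁻¹ * chi n j) = 0) :
      x ⬝ᵥ (normAdj ω *ᵥ x) ≤ 20 * X / d * (x ⬝ᵥ x) := by
    set y : Fin (2 * n) → ℝ := fun j => x j / Real.sqrt (deg ω j) with hy
    have hy1 : ∑ j, y j = 0 := by
      rw [← hp]
      exact Finset.sum_congr rfl fun j _ => div_eq_mul_inv _ _
    have hy2 : chi n ⬝ᵥ y = 0 := by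
      rw [← hq]
      exact Finset.sum_congr rfl fun j _ => by
        simp only [hy]
        ring
    have hA : adjOf ω *ᵥ y = (adjOf ω - Bmat n a b) *ᵥ y := by
      funext j
      rw [adjOf_mulVec_apply a b, Bmat_mulVec_apply, hy1, hy2]
      simp
    have h1 := dotProduct_mulVec_self_le hE y
    rw [← hA] at h1
    have h2 : d / 20 * (y ⬝ᵥ y) ≤ x ⬝ᵥ x := by
      rw [dotProduct_self_eq_sum_deg_mul hpos x, dotProduct, Finset.mul_sum]
      refine Finset.sum_le_sum fun j _ => ?_
      rw [← pow_two]
      exact mul_le_mul_of_nonneg_right (hdeg j) (sq_nonneg _)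
    rw [dotProduct_normAdj_mulVec]
    refine h1.trans ?_
    have h3 : X * (y ⬝ᵥ y) = 20 * X / d * (d / 20 * (y ⬝ᵥ y)) := by field_simp
    rw [h3]
    exact mul_le_mul_of_nonneg_left h2 (by positivity)
  have hη := sum_sq_normAdj_residual_le hE hδ hdeg hs0.le hd (by linarith)
  have hρ : (v ⬝ᵥ u) ^ 2 ≤ 4 * n * K ^ 2 * (u ⬝ᵥ u) := by
    rw [hvu, huu]
    refine (sq_sum_deg_mul_chi_le hE).trans ?_
    calc (2 * n * X) ^ 2 = 4 * n * K ^ 2 * (n * d) := by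
          rw [mul_pow, hX2]
          ring
      _ ≤ _ := mul_le_mul_of_nonneg_left hvol' (by positivity)
  have hQ : 4 * (8 * n * X ^ 2 / (d / 20)) / (s / d) ^ 2 + 4 * n * K ^ 2 ≤
      n * (644 * K ^ 2 * d ^ 2 / s ^ 2) := by
    have h1 : 4 * (8 * n * X ^ 2 / (d / 20)) / (s / d) ^ 2 = 640 * n * K ^ 2 * (d ^ 2 / s ^ 2) := by
      rw [hX2]
      field_simp
      norm_num
    have h2 : 1 ≤ d ^ 2 / s ^ 2 := by
      rw [one_le_div (by positivity)]
      exact pow_le_pow_left₀ hs0.le hsd 2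
    have h3 : n * (644 * K ^ 2 * d ^ 2 / s ^ 2) = 644 * n * K ^ 2 * (d ^ 2 / s ^ 2) := by ring
    rw [h1, h3]
    have h4 : 0 ≤ n * K ^ 2 := by positivity
    nlinarith
  have hlt : 4 * (8 * n * X ^ 2 / (d / 20)) / (s / d) ^ 2 + 4 * n * K ^ 2 < v ⬝ᵥ v := by
    rw [hvv]
    refine hQ.trans_lt (lt_of_lt_of_le ?_ hvol')
    refine (mul_le_mul_of_nonneg_left hq hn'.le).trans_lt ?_
    exact mul_lt_mul_of_pos_left (by linarith) hn'
  have hμ : 0 < s / d := by positivity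
  have hθμ : 20 * X / d ≤ s / d / 2 := by
    rw [div_div, div_le_div_iff₀ hd (by positivity)]
    nlinarith
  have hfinal := norm_sq_sub_inner_sq_le hH hlam hanti hi hle hu0 hu huniq hθ hμ hθμ hη hρ hlt hw hw1
  rw [hvv] at hfinal
  exact hfinal.trans hQ

lemma IsTypical.exists_exceptional_set {n : ℕ} {a b K : ℝ}
    {ω : Fin (2 * n) → Fin (2 * n) → Bool} (h : IsTypical n a b K ω) (hK : 1 ≤ K) (hb : 1 ≤ b)
    (hs : 10 ^ 9 * K ^ 2 * Real.sqrt (a + b) ≤ a - b) (hd : 0 < a + b)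
    (hH : (normAdj ω).IsHermitian) {lam : Fin (2 * n) → ℝ} {σ : Equiv.Perm (Fin (2 * n))}
    (hlam : lam = hH.eigenvalues ∘ σ) (hanti : Antitone lam) {i : Fin (2 * n)} (hi : i.val = 1)
    {w : Fin (2 * n) → ℝ} (hw : normAdj ω *ᵥ w = lam i • w) (hw1 : ∑ j, w j ^ 2 = 1)
    (hwχ : 0 ≤ ∑ j, w j * chi n j) :
    ∃ S : Finset (Fin (2 * n)), (S.card : ℝ) ≤ 10 ^ 9 * K ^ 2 * n * (a + b) / (a - b) ^ 2 ∧
      ∀ v : Fin (2 * n), v ∉ S →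
        |Real.sqrt (2 * n * (a + b)) * (w v / Real.sqrt (deg ω v)) - chi n v| ≤ 1 / 100 := by
  have hww : w ⬝ᵥ w = 1 := by
    rw [← hw1]
    exact Finset.sum_congr rfl fun j _ => (pow_two _).symm
  have hmain := h.sq_norm_sub_sq_inner_le hK hb hs hd hH hlam hanti hi hw hww
  obtain ⟨hs0, hXs, hq⟩ := parameter_bounds hK hd hs
  have hn : 0 < n := by
    have := i.isLt
    omega
  have hn' : (0 : ℝ) < n := by exact_mod_cast hn
  have hvol := abs_le.1 (abs_sum_deg_sub_le h.1)
  have hdeg (j : Fin (2 * n)) : (a + b) / 20 ≤ deg ω j := le_trans (by linarith) (h.le_deg j)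
  have hsd : a - b ≤ a + b := by linarith
  set X := K * Real.sqrt (a + b) with hX
  set d := a + b with hddef
  set s := a - b with hsdef
  set q := 644 * K ^ 2 * d ^ 2 / s ^ 2 with hqdef
  have hδ : 0 < d / 20 := by positivity
  have hpos (j : Fin (2 * n)) : 0 < deg ω j := hδ.trans_le (hdeg j)
  have hr (j : Fin (2 * n)) : 0 < Real.sqrt (deg ω j) := Real.sqrt_pos.2 (hpos j)
  have hrr (j : Fin (2 * n)) : Real.sqrt (deg ω j) ^ 2 = deg ω j := Real.sq_sqrt (hpos j).le
  set β := (fun j => Real.sqrt (deg ω j) * chi n j) ⬝ᵥ w with hβ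
  have hβsum : β = ∑ j, Real.sqrt (deg ω j) * chi n j * w j := rfl
  have he : ∑ j, (Real.sqrt (deg ω j) * chi n j - β * w j) ^ 2 = ∑ j, deg ω j - β ^ 2 := by
    have h1 (j : Fin (2 * n)) : (Real.sqrt (deg ω j) * chi n j - β * w j) ^ 2 =
        deg ω j - 2 * β * (Real.sqrt (deg ω j) * chi n j * w j) + β ^ 2 * w j ^ 2 := by
      calc _ = Real.sqrt (deg ω j) ^ 2 * chi n j ^ 2
            - 2 * β * (Real.sqrt (deg ω j) * chi n j * w j) + β ^ 2 * w j ^ 2 := by ring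
        _ = _ := by rw [hrr, chi_sq, mul_one]
    simp_rw [h1]
    rw [Finset.sum_add_distrib, Finset.sum_sub_distrib, ← Finset.mul_sum, ← Finset.mul_sum, hw1,
      ← hβsum]
    ring
  have hnq : n * q ≤ n * (d / 10 ^ 5) := mul_le_mul_of_nonneg_left hq hn'.le
  have hnX : n * X ≤ n * (d / 10 ^ 9) := mul_le_mul_of_nonneg_left (by linarith) hn'.le
  have hnd : 0 < n * d := by positivity
  have he0 : 0 ≤ ∑ j, deg ω j - β ^ 2 := he ▸ Finset.sum_nonneg fun j _ => sq_nonneg _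
  have hβpos : 0 < β := by
    set c := Real.sqrt (d / 20) with hc
    have hc0 : 0 < c := Real.sqrt_pos.2 hδ
    have hcc : c ^ 2 = d / 20 := Real.sq_sqrt hδ.le
    have h1 : ∑ j : Fin (2 * n), (c ^ 2 - (Real.sqrt (deg ω j) * chi n j - β * w j) ^ 2) ≤
        ∑ j, 2 * c * β * (w j * chi n j) := by
      refine Finset.sum_le_sum fun j _ => ?_
      have h2 : c ≤ Real.sqrt (deg ω j) := Real.sqrt_le_sqrt (hdeg j)
      have h3 := chi_sq n j
      have h4 : 2 * c * β * (w j * chi n j) = 2 * c * Real.sqrt (deg ω j) * chi n j ^ 2 -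
          2 * c * ((Real.sqrt (deg ω j) * chi n j - β * w j) * chi n j) := by ring
      have h5 := sq_nonneg (c * chi n j - (Real.sqrt (deg ω j) * chi n j - β * w j))
      rw [h4, h3]
      nlinarith
    rw [Finset.sum_sub_distrib, he, ← Finset.mul_sum, hcc] at h1
    simp only [Finset.sum_const, Finset.card_univ, Fintype.card_fin, nsmul_eq_mul] at h1
    push_cast at h1
    have h2 : 0 < 2 * c * β * ∑ j, w j * chi n j := by
      refine lt_of_lt_of_le ?_ h1
      linarith
    by_contra! hcon
    exact h2.not_ge (mul_nonpos_of_nonpos_of_nonneg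
      (mul_nonpos_of_nonneg_of_nonpos (by positivity) hcon) hwχ)
  set γ := Real.sqrt (2 * n * d) / β with hγ
  have hγ0 : 0 ≤ γ := by positivity
  have hγβ : γ ^ 2 * β ^ 2 = 2 * (n * d) := by
    rw [hγ, div_pow, Real.sq_sqrt (by positivity), div_mul_cancel₀ _ (by positivity)]
    ring
  have hβlo : 2 * (n * d) * (1 - 1 / 10 ^ 5) ≤ β ^ 2 := by linarith
  have hβhi : β ^ 2 ≤ 2 * (n * d) * (1 + 1 / 10 ^ 5) := by linarith
  have hγhi : γ ≤ 1 + 1 / 1000 := by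
    by_contra! hcon
    have h1 : (1 + 1 / 1000) ^ 2 ≤ γ ^ 2 := pow_le_pow_left₀ (by norm_num) hcon.le 2
    have h2 := mul_le_mul h1 hβlo (by positivity) (by positivity)
    rw [hγβ] at h2
    nlinarith
  have hγlo : 1 - 1 / 1000 ≤ γ := by
    by_contra! hcon
    have h1 : γ ^ 2 ≤ (1 - 1 / 1000) ^ 2 := pow_le_pow_left₀ hγ0 hcon.le 2
    have h2 := mul_le_mul h1 hβhi (by positivity) (by positivity)
    rw [hγβ] at h2
    nlinarith
  set t : Fin (2 * n) → ℝ := fun j => chi n j - β * (w j / Real.sqrt (deg ω j)) with ht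
  refine ⟨Finset.univ.filter fun j => 1 / 200 < |t j|, ?_, fun v hv => ?_⟩
  · have h1 : ((Finset.univ.filter fun j => 1 / 200 < |t j|).card : ℝ) * (d / 20 * (1 / 200) ^ 2) ≤
        n * q := by
      rw [← nsmul_eq_mul]
      refine (Finset.card_nsmul_le_sum _
        (fun j => (Real.sqrt (deg ω j) * chi n j - β * w j) ^ 2) _ fun j hj => ?_).trans ?_
      · have h2 : Real.sqrt (deg ω j) * chi n j - β * w j = Real.sqrt (deg ω j) * t j := by
          have := (hr j).ne'
          simp only [ht]
          field_simp
        rw [h2, mul_pow, hrr, ← sq_abs (t j)]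
        exact mul_le_mul (hdeg j)
          (pow_le_pow_left₀ (by norm_num) (Finset.mem_filter.1 hj).2.le 2) (by positivity)
          (hpos j).le
      · exact (Finset.sum_le_sum_of_subset_of_nonneg (Finset.subset_univ _)
          fun _ _ _ => sq_nonneg _).trans (he.trans_le hmain)
    rw [← le_div_iff₀ (by positivity)] at h1
    refine h1.trans ?_
    have h2 : n * q / (d / 20 * (1 / 200) ^ 2) = 515200000 * (K ^ 2 * n * d / s ^ 2) := by
      rw [hqdef]
      field_simp
      norm_num
    have h3 : 10 ^ 9 * K ^ 2 * n * d / s ^ 2 = 10 ^ 9 * (K ^ 2 * n * d / s ^ 2) := by ring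
    rw [h2, h3]
    exact mul_le_mul_of_nonneg_right (by norm_num) (by positivity)
  · have htv : |t v| ≤ 1 / 200 := by simpa using hv
    have h1 : Real.sqrt (2 * n * d) * (w v / Real.sqrt (deg ω v)) - chi n v =
        (γ - 1) * chi n v - γ * t v := by
      have h2 : Real.sqrt (2 * n * d) = γ * β := by
        rw [hγ, div_mul_cancel₀ _ hβpos.ne']
      rw [h2]
      simp only [ht]
      ring
    have hχ : |chi n v| = 1 := by
      rw [← sq_eq_sq₀ (abs_nonneg _) zero_le_one, sq_abs, chi_sq, one_pow]
    have h3 : |(γ - 1) * chi n v| ≤ 1 / 1000 := by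
      rw [abs_mul, hχ, mul_one, abs_le]
      constructor <;> linarith
    have h4 : |γ * t v| ≤ (1 + 1 / 1000) * (1 / 200) := by
      rw [abs_mul, abs_of_nonneg hγ0]
      exact mul_le_mul hγhi htv (abs_nonneg _) (by norm_num)
    rw [h1]
    refine (abs_sub _ _).trans ((add_le_add h3 h4).trans (by norm_num))

/-- There are constants `C, c > 0` such that for every `ε > 0` and all
sufficiently large `n`: if `a, b ≥ 1`, `d := a + b` satisfies `5·log n < d < n^{1/3-ε}`
and `a - b ≥ C·√d`, then for `G ∼ G_{2n,a/n,b/n}`, with probability at least `1 - n^{-c}`: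
for any unit eigenvector `w₂` of `N = D^{-1/2} A D^{-1/2}` for the second-largest
eigenvalue `λ₂` with `⟨w₂, χ⟩ ≥ 0`, there is a set `S` of at most `C·n·d/(a-b)²` vertices
such that `|√(2nd)·(D^{-1/2}w₂)(i) - χ(i)| ≤ 1/100` for every vertex `i ∉ S`. -/
theorem stmt18 : ∃ C > (0:ℝ), ∃ c > (0:ℝ), ∀ ε > (0:ℝ), ∃ N0 : ℕ, ∀ n : ℕ, N0 ≤ n →
    ∀ a b : ℝ, 1 ≤ a → 1 ≤ b → 5 * Real.log n < a + b →
      a + b < (n : ℝ) ^ ((1:ℝ)/3 - ε) →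
      C * Real.sqrt (a + b) ≤ a - b →
    ENNReal.ofReal (1 - (n : ℝ) ^ (-c)) ≤
      sbm n (a / n) (b / n)
        {ω | (∀ i, 0 < deg ω i) ∧
          ∀ (hH : (normAdj ω).IsHermitian) (lam : Fin (2*n) → ℝ)
            (σ : Equiv.Perm (Fin (2*n))),
            lam = hH.eigenvalues ∘ σ → Antitone lam →
            ∀ i : Fin (2*n), i.val = 1 →
            ∀ w2 : Fin (2*n) → ℝ,
              normAdj ω *ᵥ w2 = lam i • w2 → (∑ j, w2 j ^ 2) = 1 →
              0 ≤ ∑ j, w2 j * chi n j →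
              ∃ S : Finset (Fin (2*n)),
                (S.card : ℝ) ≤ C * n * (a + b) / (a - b) ^ 2 ∧
                ∀ v : Fin (2*n), v ∉ S →
                  |Real.sqrt (2 * n * (a + b)) * (w2 v / Real.sqrt (deg ω v)) - chi n v|
                    ≤ 1 / 100} := by
  obtain ⟨K, hK, N0, hN⟩ := exists_sbm_typical_ge
  refine ⟨10 ^ 9 * K ^ 2, by positivity, 1 / 4, by norm_num, fun ε hε => ⟨max N0 1, ?_⟩⟩
  intro n hn a b ha hb hlog hdn hs
  have hn1 : (1 : ℝ) ≤ n := by exact_mod_cast (le_max_right _ _).trans hn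
  have hd : 0 < a + b := by linarith
  have hab : b ≤ a := by
    have h1 : 0 ≤ 10 ^ 9 * K ^ 2 * Real.sqrt (a + b) := by positivity
    linarith
  have hdn' : a + b ≤ n := by
    refine hdn.le.trans ((Real.rpow_le_rpow_of_exponent_le hn1 ?_).trans_eq (Real.rpow_one _))
    linarith
  refine (hN n ((le_max_left _ _).trans hn) a b hb hab hlog hdn').trans (measure_mono ?_)
  intro ω hω
  refine ⟨fun i => lt_of_lt_of_le (by linarith) (hω.le_deg i), ?_⟩
  intro hH lam σ hlam hanti i hi w hw hw1 hwχ
  exact hω.exists_exceptional_set hK hb hs hd hH hlam hanti hi hw hw1 hwχ
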